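/- Let c be a real number with 1 < c < 4109054/1999527 and c ≠ 2, let ε > 0 be fixed and sufficiently small, let P be sufficiently large, τ = P^{1-c-ε}, and let X satisfy P^{9449/10000} ≪ X ≪ P. Set H = X^{38687/2666036}. Let (c_h(α)) be complex numbers with |c_h(α)| ≪ (1 + |h|)^{-1}, let a(m) be complex coefficients with a(m) ≪ m^{ε}, and let M, K satisfy MK ≍ X (i.e. c1·X ≤ MK ≤ c2·X for fixed positive constants c1, c2) and M ≪ X^{1371705/2666036}. Then for every α ∈ (τ, 1-τ), the Type I sum S_I(α) = Σ_{|h| ≤ H} c_h(α) Σ_{M < m ≤ 2M} a(m) Σ_{K < k ≤ 2K} e((h+α)(mk)^c) satisfies S_I(α) ≪ X^{2627349/2666036 + ε}. -/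

import Mathlib

open scoped Classical
open Finset Real

/-- `eC x = e(x) = e^{2πix}`. -/
noncomputable def eC (x : ℝ) : ℂ := Complex.exp ((2 * Real.pi * x : ℝ) * Complex.I)

theorem norm_eC (x : ℝ) : ‖eC x‖ = 1 := Complex.norm_exp_ofReal_mul_I _

theorem eC_add (x y : ℝ) : eC (x + y) = eC x * eC y := by
  rw [eC, eC, eC, ← Complex.exp_add]
  congr 1
  push_cast
  ring

theorem eC_int (j : ℤ) : eC j = 1 := by
  rw [eC, Complex.exp_eq_one_iff]
  exact ⟨j, by push_cast; ring⟩

theorem conj_eC (x : ℝ) : (starRingEnd ℂ) (eC x) = eC (-x) := by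
  rw [eC, eC, ← Complex.exp_conj]
  congr 1
  rw [map_mul, Complex.conj_I, Complex.conj_ofReal]
  push_cast
  ring

theorem eC_eq (x : ℝ) :
    eC x = (Real.cos (π * x) + Real.sin (π * x) * Complex.I) ^ 2 := by
  have h : eC x = Complex.exp ((π * x : ℝ) * Complex.I) ^ 2 := by
    rw [eC, ← Complex.exp_nat_mul]
    congr 1
    push_cast
    ring
  rw [h, Complex.exp_mul_I, Complex.ofReal_cos, Complex.ofReal_sin]

theorem norm_sum_eC_neg {ι : Type*} (s : Finset ι) (f : ι → ℝ) :
    ‖∑ i ∈ s, eC (-f i)‖ = ‖∑ i ∈ s, eC (f i)‖ := by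
  rw [← RCLike.norm_conj, map_sum]
  simp [conj_eC]

theorem norm_sum_eC_le_card {ι : Type*} (s : Finset ι) (f : ι → ℝ) :
    ‖∑ i ∈ s, eC (f i)‖ ≤ #s := by
  refine (norm_sum_le _ _).trans ?_
  simp [norm_eC]

/-- Half of the cotangent of `π x`. -/
noncomputable def halfCot (x : ℝ) : ℝ := Real.cos (π * x) / (2 * Real.sin (π * x))

theorem sin_pi_mul_ge {θ x : ℝ} (hθ : 0 < θ) (h1 : θ ≤ x) (h2 : x ≤ 1 - θ) :
    2 * θ ≤ Real.sin (π * x) := by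
  have hp := Real.pi_pos
  have key : ∀ y : ℝ, θ ≤ y → y ≤ 1 / 2 → 2 * θ ≤ Real.sin (π * y) := by
    intro y hy1 hy2
    have h := Real.mul_le_sin (x := π * y) (mul_nonneg hp.le (by linarith)) (by nlinarith)
    have e : 2 / π * (π * y) = 2 * y := by field_simp
    linarith
  rcases le_total x (1 / 2) with h | h
  · exact key x h1 h
  · have h' := key (1 - x) (by linarith) (by linarith)
    rwa [show π * (1 - x) = π - π * x by ring, Real.sin_pi_sub] at h'

theorem abs_halfCot_le {θ x : ℝ} (hθ : 0 < θ) (h1 : θ ≤ x) (h2 : x ≤ 1 - θ) :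
    |halfCot x| ≤ 1 / (4 * θ) := by
  have hs := sin_pi_mul_ge hθ h1 h2
  rw [halfCot, abs_div, abs_of_pos (show 0 < 2 * Real.sin (π * x) by linarith)]
  exact div_le_div₀ zero_le_one (Real.abs_cos_le_one _) (by linarith) (by linarith)

theorem halfCot_antitone {θ x y : ℝ} (hθ : 0 < θ) (h1 : θ ≤ x) (hxy : x ≤ y) (h2 : y ≤ 1 - θ) :
    halfCot y ≤ halfCot x := by
  have hx := sin_pi_mul_ge hθ h1 (hxy.trans h2)
  have hy := sin_pi_mul_ge hθ (h1.trans hxy) h2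
  have hd : 0 ≤ Real.sin (π * y - π * x) := by
    apply Real.sin_nonneg_of_nonneg_of_le_pi
    · nlinarith [Real.pi_pos]
    · nlinarith [Real.pi_pos]
  rw [Real.sin_sub] at hd
  rw [halfCot, halfCot, div_le_div_iff₀ (by linarith) (by linarith)]
  linarith

theorem halfCot_mul {x : ℝ} (hs : Real.sin (π * x) ≠ 0) :
    (-(1 / 2) - halfCot x * Complex.I) * (eC x - 1) = 1 := by
  have hc : ((Real.cos (π * x) : ℝ) : ℂ) ^ 2 + ((Real.sin (π * x) : ℝ) : ℂ) ^ 2 = 1 := by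
    exact_mod_cast Real.cos_sq_add_sin_sq (π * x)
  have hs' : ((Real.sin (π * x) : ℝ) : ℂ) ≠ 0 := by exact_mod_cast hs
  rw [eC_eq, halfCot, Complex.ofReal_div, Complex.ofReal_mul, Complex.ofReal_ofNat]
  generalize ((Real.cos (π * x) : ℝ) : ℂ) = C at *
  generalize ((Real.sin (π * x) : ℝ) : ℂ) = S at *
  have h1 : (C + S * Complex.I) ^ 2 - 1 = 2 * S * Complex.I * (C + S * Complex.I) := by
    linear_combination hc - S ^ 2 * Complex.I_sq
  rw [h1]
  field_simp
  linear_combination (-Complex.I ^ 2) * hc - (1 + Complex.I * S * C) * Complex.I_sq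

theorem norm_halfCot_le {θ x : ℝ} (hθ : 0 < θ) (h1 : θ ≤ x) (h2 : x ≤ 1 - θ) :
    ‖(-(1 / 2) - halfCot x * Complex.I : ℂ)‖ ≤ 1 / 2 + 1 / (4 * θ) := by
  refine (norm_sub_le _ _).trans ?_
  gcongr
  · norm_num
  · simpa using abs_halfCot_le hθ h1 h2

/-- The Kuzmin–Landau inequality for increments in `[θ, 1 - θ]`. -/
theorem kuzmin_landau_aux (f : ℕ → ℝ) {θ : ℝ} (hθ : 0 < θ) (hθ2 : θ ≤ 1 / 2) (L : ℕ)
    (h1 : ∀ n ≤ L, θ ≤ f (n + 1) - f n) (h2 : ∀ n ≤ L, f (n + 1) - f n ≤ 1 - θ)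
    (hm : ∀ n < L, f (n + 1) - f n ≤ f (n + 2) - f (n + 1)) :
    ‖∑ n ∈ range (L + 1), eC (f n)‖ ≤ 3 / θ := by
  set d : ℕ → ℝ := fun n => f (n + 1) - f n with hd
  set g : ℕ → ℂ := fun n => -(1 / 2) - halfCot (d n) * Complex.I with hg
  have hgE : ∀ n ≤ L, eC (f n) = g n * (eC (f (n + 1)) - eC (f n)) := by
    intro n hn
    have hs := sin_pi_mul_ge hθ (h1 n hn) (h2 n hn)
    have := halfCot_mul (x := d n) (by simp only [hd]; linarith)
    have e : eC (f (n + 1)) = eC (f n) * eC (d n) := by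
      rw [← eC_add]; congr 1; simp [hd]
    rw [e]
    linear_combination (-eC (f n)) * this
  have key : ∀ l ≤ L, ‖∑ n ∈ range (l + 1), eC (f n) - g l * eC (f (l + 1))‖
      ≤ ‖g 0‖ + (halfCot (d 0) - halfCot (d l)) := by
    intro l
    induction l with
    | zero =>
      intro hl
      have := hgE 0 hl
      have e : ∑ n ∈ range (0 + 1), eC (f n) - g 0 * eC (f (0 + 1)) = - (g 0 * eC (f 0)) := by
        rw [zero_add, Finset.sum_range_one]
        linear_combination this
      rw [e, norm_neg, norm_mul, norm_eC]
      simp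
    | succ l ih =>
      intro hl
      have ih := ih (by omega)
      have := hgE (l + 1) hl
      have e : ∑ n ∈ range (l + 1 + 1), eC (f n) - g (l + 1) * eC (f (l + 1 + 1)) =
          (∑ n ∈ range (l + 1), eC (f n) - g l * eC (f (l + 1))) +
            (g l - g (l + 1)) * eC (f (l + 1)) := by
        rw [Finset.sum_range_succ]
        linear_combination this
      have hmono := halfCot_antitone hθ (h1 l (by omega)) (hm l (by omega)) (h2 (l + 1) hl)
      have e2 : ‖g l - g (l + 1)‖ = halfCot (d l) - halfCot (d (l + 1)) := by
        have : g l - g (l + 1) = ((halfCot (d (l + 1)) - halfCot (d l) : ℝ) : ℂ) * Complex.I := by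
          simp only [hg]; push_cast; ring
        rw [this, norm_mul, Complex.norm_I, mul_one, Complex.norm_real, Real.norm_eq_abs,
          abs_sub_comm, abs_of_nonneg]
        exact sub_nonneg.2 hmono
      rw [e]
      refine (norm_add_le _ _).trans ?_
      rw [norm_mul, norm_eC, mul_one, e2]
      linarith
  have hk := key L le_rfl
  have hg0 := norm_halfCot_le hθ (h1 0 (Nat.zero_le _)) (h2 0 (Nat.zero_le _))
  have hgL := norm_halfCot_le hθ (h1 L le_rfl) (h2 L le_rfl)
  have hc0 := (abs_le.1 (abs_halfCot_le hθ (h1 0 (Nat.zero_le _)) (h2 0 (Nat.zero_le _)))).2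
  have hcL := (abs_le.1 (abs_halfCot_le hθ (h1 L le_rfl) (h2 L le_rfl))).1
  have e : ∑ n ∈ range (L + 1), eC (f n) =
    (∑ n ∈ range (L + 1), eC (f n) - g L * eC (f (L + 1))) + g L * eC (f (L + 1)) := by ring
  rw [e]
  refine (norm_add_le _ _).trans ?_
  rw [norm_mul, norm_eC, mul_one]
  have h5 : 1 ≤ 2 * (1 / (4 * θ)) := by
    rw [← mul_div_assoc, le_div_iff₀ (by positivity)]
    linarith
  have h6 : 3 / θ = 12 * (1 / (4 * θ)) := by field_simp; norm_num
  rw [h6]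
  linarith

/-- The Kuzmin–Landau inequality. -/
theorem kuzmin_landau (f : ℕ → ℝ) (j : ℤ) {θ : ℝ} (hθ : 0 < θ) (hθ2 : θ ≤ 1 / 2) (a b : ℕ)
    (h1 : ∀ n ∈ Finset.Ico a b, j + θ ≤ f (n + 1) - f n)
    (h2 : ∀ n ∈ Finset.Ico a b, f (n + 1) - f n ≤ j + 1 - θ)
    (hm : ∀ n ∈ Finset.Ico a b, f (n + 1) - f n ≤ f (n + 2) - f (n + 1)) :
    ‖∑ n ∈ Finset.Ico a b, eC (f n)‖ ≤ 3 / θ := by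
  rcases le_or_gt b a with hab | hab
  · rw [Finset.Ico_eq_empty_of_le hab]
    simp only [Finset.sum_empty, norm_zero]
    positivity
  obtain ⟨L, rfl⟩ : ∃ L, b = a + (L + 1) := ⟨b - a - 1, by omega⟩
  rw [Finset.sum_Ico_eq_sum_range, show a + (L + 1) - a = L + 1 by omega]
  have e : ∀ n : ℕ, eC (f (a + n)) = eC (f (a + n) - j * n) := by
    intro n
    have h := eC_add (f (a + n) - j * n) ((j * n : ℤ) : ℝ)
    rw [eC_int, mul_one] at h
    rw [← h]
    congr 1
    push_cast
    ring
  simp only [e]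
  refine kuzmin_landau_aux (fun n => f (a + n) - j * n) hθ hθ2 L ?_ ?_ ?_
  · intro n hn
    have := h1 (a + n) (by simp; omega)
    simp only [← add_assoc]
    push_cast
    linarith
  · intro n hn
    have := h2 (a + n) (by simp; omega)
    simp only [← add_assoc]
    push_cast
    linarith
  · intro n hn
    have := hm (a + n) (by simp; omega)
    simp only [← add_assoc]
    push_cast
    linarith

theorem exists_eq_Ico_of_convex (s : Finset ℕ)
    (h : ∀ x ∈ s, ∀ z ∈ s, ∀ y, x ≤ y → y ≤ z → y ∈ s) : ∃ a b, s = Finset.Ico a b := by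
  rcases s.eq_empty_or_nonempty with rfl | hs
  · exact ⟨0, 0, by simp⟩
  · refine ⟨s.min' hs, s.max' hs + 1, ?_⟩
    ext y
    simp only [Finset.mem_Ico, Nat.lt_add_one_iff]
    exact ⟨fun hy => ⟨s.min'_le y hy, s.le_max' y hy⟩,
      fun hy => h _ (s.min'_mem hs) _ (s.max'_mem hs) _ hy.1 hy.2⟩

theorem exists_filter_eq_Ico {N : ℕ} {d : ℕ → ℝ} (hd : ∀ m n, m ≤ n → n < N → d m ≤ d n)
    (x y : ℝ) : ∃ a b, (range N).filter (fun n => x ≤ d n ∧ d n ≤ y) = Finset.Ico a b := by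
  apply exists_eq_Ico_of_convex
  simp only [Finset.mem_filter, Finset.mem_range]
  intro u hu v hv w huw hwv
  exact ⟨by omega, hu.2.1.trans (hd u w huw (by omega)), (hd w v hwv hv.1).trans hv.2.2⟩

/-- A sequence with gaps at least `l` has few terms in a short interval. -/
theorem card_filter_le {N : ℕ} {d : ℕ → ℝ} {l : ℝ} (hl : 0 < l)
    (hd : ∀ m n, m ≤ n → n < N → l * ((n : ℝ) - m) ≤ d n - d m) {x y : ℝ} (hxy : x ≤ y) :
    (#((range N).filter (fun n => x ≤ d n ∧ d n ≤ y)) : ℝ) ≤ (y - x) / l + 1 := by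
  obtain ⟨a, b, hab⟩ := exists_filter_eq_Ico (N := N) (d := d) (fun m n hmn hn => by
    have h1 := hd m n hmn hn
    have h2 : (0 : ℝ) ≤ (n : ℝ) - m := sub_nonneg.2 (by exact_mod_cast hmn)
    nlinarith [mul_nonneg hl.le h2]) x y
  rw [hab, Nat.card_Ico]
  rcases le_or_gt b a with h | h
  · rw [Nat.sub_eq_zero_of_le h, Nat.cast_zero]
    have : 0 ≤ (y - x) / l := div_nonneg (sub_nonneg.2 hxy) hl.le
    linarith
  · have ha : a ∈ Finset.Ico a b := by simp [h]
    have hb : b - 1 ∈ Finset.Ico a b := by simp; omega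
    rw [← hab, Finset.mem_filter, Finset.mem_range] at ha hb
    have h3 := hd a (b - 1) (by omega) hb.1
    rw [Nat.cast_sub h.le]
    rw [Nat.cast_sub (by omega)] at h3
    rw [← sub_le_iff_le_add, le_div_iff₀ hl]
    have := ha.2.1
    have := hb.2.2
    push_cast at h3
    nlinarith

/-- The second derivative test, with second differences in place of second derivatives. -/
theorem second_difference_test (C : ℝ) (hC : 1 ≤ C) :
    ∃ B > 0, ∀ (N : ℕ) (f : ℕ → ℝ) (l : ℝ), 0 < l →
      (∀ n < N, l ≤ f (n + 2) - f (n + 1) - (f (n + 1) - f n)) →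
      (∀ n < N, f (n + 2) - f (n + 1) - (f (n + 1) - f n) ≤ C * l) →
      ‖∑ n ∈ range N, eC (f n)‖ ≤ B * (N * √l + 1 / √l) := by
  refine ⟨14 * C + 14, by linarith, fun N f l hl h1 h2 => ?_⟩
  have hs : 0 < √l := Real.sqrt_pos.2 hl
  have hss : √l * √l = l := Real.mul_self_sqrt hl.le
  rcases Nat.eq_zero_or_pos N with rfl | hN
  · simp only [Finset.range_zero, Finset.sum_empty, norm_zero]
    positivity
  by_cases hbig : 1 / 2 ≤ √l
  · refine (norm_sum_eC_le_card _ _).trans ?_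
    rw [Finset.card_range]
    have : 0 < 1 / √l := by positivity
    have hN' : (0 : ℝ) ≤ N := Nat.cast_nonneg _
    nlinarith [mul_nonneg hN' hs.le, mul_le_mul_of_nonneg_left hbig hN',
      mul_nonneg (mul_nonneg hN' hs.le) (by linarith : 0 ≤ C)]
  push Not at hbig
  set d : ℕ → ℝ := fun n => f (n + 1) - f n with hd
  have hlow : ∀ m n, m ≤ n → n < N → l * ((n : ℝ) - m) ≤ d n - d m := by
    intro m n hmn
    induction n, hmn using Nat.le_induction with
    | base => intro _; simp
    | succ n hmn ih =>
      intro hn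
      have := ih (by omega)
      have := h1 n (by omega)
      simp only [hd] at *
      push_cast
      linarith
  have hup : ∀ n < N, d n - d 0 ≤ C * l * n := by
    intro n
    induction n with
    | zero => intro _; simp
    | succ n ih =>
      intro hn
      have := ih (by omega)
      have := h2 n (by omega)
      simp only [hd] at *
      push_cast
      linarith
  have hmono : ∀ m n, m ≤ n → n < N → d m ≤ d n := by
    intro m n hmn hn
    have h3 := hlow m n hmn hn
    have h4 : (0 : ℝ) ≤ (n : ℝ) - m := sub_nonneg.2 (by exact_mod_cast hmn)
    nlinarith [mul_nonneg hl.le h4]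
  have hblock : ∀ j : ℤ, ‖∑ n ∈ (range N).filter (fun n => ⌊d n⌋ = j), eC (f n)‖ ≤ 7 / √l := by
    intro j
    set s := (range N).filter (fun n => ⌊d n⌋ = j) with hsdef
    set s2 := (range N).filter (fun n => j + √l ≤ d n ∧ d n ≤ j + 1 - √l) with hs2
    set s1 := (range N).filter (fun n => (j : ℝ) ≤ d n ∧ d n ≤ j + √l) with hs1
    set s3 := (range N).filter (fun n => (j : ℝ) + 1 - √l ≤ d n ∧ d n ≤ j + 1) with hs3
    have hsub : s2 ⊆ s := by
      intro n hn
      simp only [hs2, hsdef, Finset.mem_filter] at hn ⊢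
      refine ⟨hn.1, Int.floor_eq_iff.2 ⟨by linarith, by linarith⟩⟩
    have hsub2 : s \ s2 ⊆ s1 ∪ s3 := by
      intro n hn
      simp only [hs1, hs3, hs2, hsdef, Finset.mem_sdiff, Finset.mem_union, Finset.mem_filter,
        Int.floor_eq_iff] at hn ⊢
      obtain ⟨⟨hn1, hn2, hn3⟩, hn4⟩ := hn
      by_cases h : d n ≤ j + √l
      · exact Or.inl ⟨hn1, hn2, h⟩
      · refine Or.inr ⟨hn1, ?_, hn3.le⟩
        by_contra h'
        exact hn4 ⟨hn1, by linarith, by linarith⟩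
    have hc1 : (#s1 : ℝ) ≤ 1 / √l + 1 := by
      refine (card_filter_le hl hlow (by linarith)).trans (le_of_eq ?_)
      rw [add_sub_cancel_left, Real.sqrt_div_self']
    have hc3 : (#s3 : ℝ) ≤ 1 / √l + 1 := by
      refine (card_filter_le hl hlow (by linarith)).trans (le_of_eq ?_)
      rw [sub_sub_cancel, Real.sqrt_div_self']
    have hc : (#(s \ s2) : ℝ) ≤ 2 / √l + 2 := by
      have h5 : #(s \ s2) ≤ #s1 + #s3 :=
        (Finset.card_le_card hsub2).trans (Finset.card_union_le _ _)
      have h6 : (#(s \ s2) : ℝ) ≤ #s1 + #s3 := by exact_mod_cast h5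
      have : 2 / √l = 1 / √l + 1 / √l := by ring
      linarith
    have hmid : ‖∑ n ∈ s2, eC (f n)‖ ≤ 3 / √l := by
      obtain ⟨a, b, hab⟩ := exists_filter_eq_Ico hmono (j + √l) (j + 1 - √l)
      have hmem : ∀ n, n ∈ Finset.Ico a b → n < N ∧ j + √l ≤ d n ∧ d n ≤ j + 1 - √l := by
        intro n hn
        rw [← hab, Finset.mem_filter, Finset.mem_range] at hn
        exact hn
      rw [hs2, hab]
      refine kuzmin_landau f j hs hbig.le a b (fun n hn => (hmem n hn).2.1)
        (fun n hn => (hmem n hn).2.2) (fun n hn => ?_)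
      have := h1 n (hmem n hn).1
      linarith
    rw [← Finset.sum_sdiff hsub]
    refine (norm_add_le _ _).trans ?_
    have h7 := norm_sum_eC_le_card (s \ s2) f
    have h8 : 1 ≤ 1 / √l := by rw [le_div_iff₀ hs]; linarith
    have h9 : 7 / √l = 7 * (1 / √l) := by ring
    have h10 : 3 / √l = 3 * (1 / √l) := by ring
    have h11 : 2 / √l = 2 * (1 / √l) := by ring
    rw [h9]
    rw [h10] at hmid
    rw [h11] at hc
    linarith
  have hfib : ∑ n ∈ range N, eC (f n) = ∑ j ∈ Finset.Icc ⌊d 0⌋ ⌊d (N - 1)⌋,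
      ∑ n ∈ (range N).filter (fun n => ⌊d n⌋ = j), eC (f n) := by
    symm
    apply Finset.sum_fiberwise_of_maps_to
    intro n hn
    rw [Finset.mem_range] at hn
    exact Finset.mem_Icc.2 ⟨Int.floor_mono (hmono 0 n (Nat.zero_le _) hn),
      Int.floor_mono (hmono n (N - 1) (by omega) (by omega))⟩
  rw [hfib]
  refine (norm_sum_le _ _).trans ?_
  refine (Finset.sum_le_sum fun j _ => hblock j).trans ?_
  rw [Finset.sum_const, nsmul_eq_mul, Int.card_Icc]
  have hle : ⌊d 0⌋ ≤ ⌊d (N - 1)⌋ := Int.floor_mono (hmono 0 (N - 1) (by omega) (by omega))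
  have hcard : (((⌊d (N - 1)⌋ + 1 - ⌊d 0⌋).toNat : ℕ) : ℝ) ≤ C * l * N + 2 := by
    have e : (((⌊d (N - 1)⌋ + 1 - ⌊d 0⌋).toNat : ℕ) : ℝ)
        = ((⌊d (N - 1)⌋ + 1 - ⌊d 0⌋ : ℤ) : ℝ) := by
      rw [← Int.cast_natCast, Int.toNat_of_nonneg (by omega)]
    rw [e]
    push_cast
    have h3 := Int.floor_le (d (N - 1))
    have h4 := Int.lt_floor_add_one (d 0)
    have h5 := hup (N - 1) (by omega)
    rw [Nat.cast_sub hN] at h5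
    have h6 : 0 ≤ C * l := by positivity
    push_cast at h5
    nlinarith
  have hpos : 0 < 1 / √l := by positivity
  calc (((⌊d (N - 1)⌋ + 1 - ⌊d 0⌋).toNat : ℕ) : ℝ) * (7 / √l)
      ≤ (C * l * N + 2) * (7 / √l) := by gcongr
    _ = 7 * C * (N * √l) + 14 * (1 / √l) := by
      field_simp
      linear_combination (-(7 * C * N)) * hss
    _ ≤ (14 * C + 14) * (N * √l + 1 / √l) := by
      have : (0 : ℝ) ≤ N * √l := by positivity
      nlinarith [mul_nonneg (by linarith : 0 ≤ C) this, mul_nonneg (by linarith : 0 ≤ C) hpos.le]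

theorem sum_sum_natDist_le (Q : ℕ) (g : ℕ → ℝ) (hg : ∀ n, 0 ≤ g n) :
    ∑ r ∈ range Q, ∑ t ∈ range Q, g (Nat.dist r t) ≤
      Q * (g 0 + 2 * ∑ q ∈ Finset.Ico 1 Q, g q) := by
  have key : ∀ r ∈ range Q, ∑ t ∈ range Q, g (Nat.dist r t) ≤
      g 0 + 2 * ∑ q ∈ Finset.Ico 1 Q, g q := by
    intro r hr
    rw [Finset.mem_range] at hr
    have h1 : ∑ t ∈ range r, g (Nat.dist r t) ≤ ∑ q ∈ Finset.Ico 1 Q, g q := by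
      have e : ∑ t ∈ range r, g (Nat.dist r t) = ∑ q ∈ (range r).image (fun t => r - t), g q := by
        rw [Finset.sum_image]
        · refine Finset.sum_congr rfl fun t ht => ?_
          rw [Finset.mem_range] at ht
          rw [Nat.dist_eq_sub_of_le_right ht.le]
        · intro a ha b hb hab
          simp only [Finset.coe_range, Set.mem_Iio] at ha hb
          dsimp only at hab
          omega
      rw [e]
      refine Finset.sum_le_sum_of_subset_of_nonneg ?_ fun _ _ _ => hg _
      intro q hq
      simp only [Finset.mem_image, Finset.mem_range] at hq
      obtain ⟨t, ht, rfl⟩ := hq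
      simp only [Finset.mem_Ico]
      omega
    have h2 : ∑ t ∈ Finset.Ico (r + 1) Q, g (Nat.dist r t) ≤ ∑ q ∈ Finset.Ico 1 Q, g q := by
      have e : ∑ t ∈ Finset.Ico (r + 1) Q, g (Nat.dist r t) =
          ∑ q ∈ (Finset.Ico (r + 1) Q).image (fun t => t - r), g q := by
        rw [Finset.sum_image]
        · refine Finset.sum_congr rfl fun t ht => ?_
          rw [Finset.mem_Ico] at ht
          rw [Nat.dist_eq_sub_of_le (by omega)]
        · intro a ha b hb hab
          simp only [Finset.coe_Ico, Set.mem_Ico] at ha hb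
          dsimp only at hab
          omega
      rw [e]
      refine Finset.sum_le_sum_of_subset_of_nonneg ?_ fun _ _ _ => hg _
      intro q hq
      simp only [Finset.mem_image, Finset.mem_Ico] at hq ⊢
      obtain ⟨t, ht, rfl⟩ := hq
      omega
    rw [← Finset.sum_range_add_sum_Ico _ (show r + 1 ≤ Q by omega), Finset.sum_range_succ,
      Nat.dist_self]
    linarith
  refine (Finset.sum_le_sum key).trans ?_
  rw [Finset.sum_const, nsmul_eq_mul, Finset.card_range]

theorem norm_sum_sq_le_card_mul {E ι : Type*} [NormedAddCommGroup E] (s : Finset ι) (w : ι → E) :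
    ‖∑ i ∈ s, w i‖ ^ 2 ≤ #s * ∑ i ∈ s, ‖w i‖ ^ 2 := by
  refine (pow_le_pow_left₀ (norm_nonneg _) (norm_sum_le _ _) 2).trans ?_
  exact sq_sum_le_card_mul_sum_sq

section VanDerCorput

variable {E : Type*} [NormedAddCommGroup E] [InnerProductSpace ℂ E]

theorem sum_inner_shift (N Q : ℕ) (z : ℕ → E) (hz : ∀ n, N ≤ n → z n = 0) {r t : ℕ}
    (htr : t ≤ r) (hr : r < Q) :
    ∑ m ∈ range (N + Q), inner ℂ (if r ≤ m then z (m - r) else 0) (if t ≤ m then z (m - t) else 0)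
      = ∑ n ∈ range (N - (r - t)), inner ℂ (z n) (z (n + (r - t))) := by
  rw [show N + Q = r + (N + Q - r) by omega, Finset.sum_range_add]
  have h0 : ∑ m ∈ range r, inner ℂ (if r ≤ m then z (m - r) else 0)
      (if t ≤ m then z (m - t) else 0) = 0 := by
    refine Finset.sum_eq_zero fun m hm => ?_
    rw [Finset.mem_range] at hm
    rw [if_neg (by omega), inner_zero_left]
  rw [h0, zero_add]
  have h1 : ∀ n, inner ℂ (if r ≤ r + n then z (r + n - r) else 0)
      (if t ≤ r + n then z (r + n - t) else 0) = inner ℂ (z n) (z (n + (r - t))) := by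
    intro n
    rw [if_pos (by omega), if_pos (by omega)]
    congr 2 <;> omega
  simp only [h1]
  symm
  refine Finset.sum_subset (fun n hn => ?_) (fun n _ hn => ?_)
  · simp only [Finset.mem_range] at *
    omega
  · simp only [Finset.mem_range] at *
    rw [hz (n + (r - t)) (by omega), inner_zero_right]

/-- Van der Corput's inequality in an inner product space. -/
theorem van_der_corput_inequality (N Q : ℕ) (z : ℕ → E) :
    Q * ‖∑ n ∈ range N, z n‖ ^ 2 ≤ (N + Q) *
      (∑ n ∈ range N, ‖z n‖ ^ 2 +
        2 * ∑ q ∈ Finset.Ico 1 Q, ‖∑ n ∈ range (N - q), inner ℂ (z n) (z (n + q))‖) := by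
  wlog hz : ∀ n, N ≤ n → z n = 0 generalizing z
  · have := this (fun n => if n < N then z n else 0) (fun n hn => if_neg (by omega))
    have e1 : ∑ n ∈ range N, (if n < N then z n else 0) = ∑ n ∈ range N, z n :=
      Finset.sum_congr rfl fun n hn => if_pos (Finset.mem_range.1 hn)
    have e2 : ∑ n ∈ range N, ‖(if n < N then z n else 0)‖ ^ 2 = ∑ n ∈ range N, ‖z n‖ ^ 2 :=
      Finset.sum_congr rfl fun n hn => by rw [if_pos (Finset.mem_range.1 hn)]
    have e3 : ∀ q, ∑ n ∈ range (N - q), inner ℂ (if n < N then z n else 0)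
        (if n + q < N then z (n + q) else 0) =
        ∑ n ∈ range (N - q), inner ℂ (z n) (z (n + q)) := fun q =>
      Finset.sum_congr rfl fun n hn => by
        rw [Finset.mem_range] at hn
        rw [if_pos (by omega), if_pos (by omega)]
    simp only [e1, e2, e3] at this
    exact this
  rcases Nat.eq_zero_or_pos Q with rfl | hQ
  · simp only [Nat.cast_zero, zero_mul]
    positivity
  set c : ℕ → ℝ := fun q => ‖∑ n ∈ range (N - q), inner ℂ (z n) (z (n + q))‖ with hc
  set y : ℕ → ℕ → E := fun m r => if r ≤ m then z (m - r) else 0 with hy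
  have hsum : ∑ m ∈ range (N + Q), ∑ r ∈ range Q, y m r = (Q : ℂ) • ∑ n ∈ range N, z n := by
    rw [Finset.sum_comm]
    have : ∀ r ∈ range Q, ∑ m ∈ range (N + Q), y m r = ∑ n ∈ range N, z n := by
      intro r hr
      rw [Finset.mem_range] at hr
      rw [show N + Q = r + (N + Q - r) by omega, Finset.sum_range_add]
      have h0 : ∑ m ∈ range r, y m r = 0 := by
        refine Finset.sum_eq_zero fun m hm => ?_
        rw [Finset.mem_range] at hm
        simp only [hy]
        rw [if_neg (by omega)]
      have h1 : ∀ n, y (r + n) r = z n := by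
        intro n
        simp only [hy]
        rw [if_pos (by omega)]
        congr 1
        omega
      simp only [h0, h1, zero_add]
      symm
      refine Finset.sum_subset (fun n hn => ?_) (fun n _ hn => ?_)
      · simp only [Finset.mem_range] at *
        omega
      · simp only [Finset.mem_range] at *
        exact hz n (by omega)
    rw [Finset.sum_congr rfl this, Finset.sum_const, Finset.card_range, Nat.cast_smul_eq_nsmul]
  have hcorr : ∀ r ∈ range Q, ∀ t ∈ range Q,
      ‖∑ m ∈ range (N + Q), inner ℂ (y m r) (y m t)‖ = c (Nat.dist r t) := by
    intro r hr t ht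
    rw [Finset.mem_range] at hr ht
    rcases le_total t r with h | h
    · rw [Nat.dist_eq_sub_of_le_right h, sum_inner_shift N Q z hz h hr]
    · rw [Nat.dist_eq_sub_of_le h]
      simp only [hc]
      rw [← sum_inner_shift N Q z hz h ht, ← RCLike.norm_conj, map_sum]
      simp only [hy, inner_conj_symm]
  have hsq : ∑ m ∈ range (N + Q), ‖∑ r ∈ range Q, y m r‖ ^ 2 ≤
      Q * (c 0 + 2 * ∑ q ∈ Finset.Ico 1 Q, c q) := by
    have e : ((∑ m ∈ range (N + Q), ‖∑ r ∈ range Q, y m r‖ ^ 2 : ℝ) : ℂ) =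
        ∑ r ∈ range Q, ∑ t ∈ range Q, ∑ m ∈ range (N + Q), inner ℂ (y m r) (y m t) := by
      push_cast
      have hself : ∀ v : E, ((‖v‖ : ℝ) : ℂ) ^ 2 = inner ℂ v v := fun v =>
        (inner_self_eq_norm_sq_to_K v).symm
      simp only [hself, sum_inner, inner_sum]
      rw [Finset.sum_comm]
      conv_rhs => rw [Finset.sum_comm]
      refine Finset.sum_congr rfl fun r _ => ?_
      rw [Finset.sum_comm]
    have h1 : ∑ m ∈ range (N + Q), ‖∑ r ∈ range Q, y m r‖ ^ 2 =
        ‖((∑ m ∈ range (N + Q), ‖∑ r ∈ range Q, y m r‖ ^ 2 : ℝ) : ℂ)‖ := by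
      rw [Complex.norm_real, Real.norm_of_nonneg]
      positivity
    rw [h1, e]
    refine le_trans ?_ (sum_sum_natDist_le Q c fun _ => norm_nonneg _)
    refine (norm_sum_le _ _).trans (Finset.sum_le_sum fun r hr => ?_)
    refine (norm_sum_le _ _).trans (Finset.sum_le_sum fun t ht => ?_)
    exact (hcorr r hr t ht).le
  have hc0 : c 0 ≤ ∑ n ∈ range N, ‖z n‖ ^ 2 := by
    refine (norm_sum_le _ _).trans (Finset.sum_le_sum fun n _ => ?_)
    rw [add_zero, pow_two]
    exact norm_inner_le_norm _ _
  have hCS := norm_sum_sq_le_card_mul (range (N + Q)) (fun m => ∑ r ∈ range Q, y m r)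
  rw [hsum, norm_smul, Finset.card_range, Complex.norm_natCast] at hCS
  have hQ' : (0 : ℝ) < Q := by exact_mod_cast hQ
  have hfin : (Q : ℝ) * (Q * ‖∑ n ∈ range N, z n‖ ^ 2) ≤ Q * ((N + Q) *
      (∑ n ∈ range N, ‖z n‖ ^ 2 + 2 * ∑ q ∈ Finset.Ico 1 Q, c q)) := by
    calc (Q : ℝ) * (Q * ‖∑ n ∈ range N, z n‖ ^ 2) = (Q * ‖∑ n ∈ range N, z n‖) ^ 2 := by ring
      _ ≤ _ := hCS
      _ ≤ ((N + Q : ℕ) : ℝ) * (Q * (c 0 + 2 * ∑ q ∈ Finset.Ico 1 Q, c q)) := by gcongr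
      _ ≤ ((N + Q : ℕ) : ℝ) *
          (Q * (∑ n ∈ range N, ‖z n‖ ^ 2 + 2 * ∑ q ∈ Finset.Ico 1 Q, c q)) := by gcongr
      _ = _ := by push_cast; ring
  exact le_of_mul_le_mul_left hfin hQ'

end VanDerCorput

/-- The assertion that a van der Corput estimate holds with exponents `s`, `t` for sequences whose
`m`-th differences have constant sign and order of magnitude `l`. -/
def DifferenceTest (m : ℕ) (s t : ℝ) : Prop :=
  ∀ C : ℝ, 1 ≤ C → ∃ B > 0, ∀ (N : ℕ) (f : ℕ → ℝ) (l : ℝ), 0 < l →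
    (∀ n < N, l ≤ (fwdDiff 1)^[m] f n) → (∀ n < N, (fwdDiff 1)^[m] f n ≤ C * l) →
    ‖∑ n ∈ range N, eC (f n)‖ ≤ B * (N * l ^ s + (N : ℝ) ^ (1 - t) * l ^ (-s))

theorem differenceTest_two : DifferenceTest 2 (1 / 2) 1 := by
  intro C hC
  obtain ⟨B, hB, h⟩ := second_difference_test C hC
  refine ⟨B, hB, fun N f l hl h1 h2 => ?_⟩
  have := h N f l hl h1 h2
  rwa [sub_self, Real.rpow_zero, one_mul, Real.rpow_neg hl.le, ← Real.sqrt_eq_rpow, ← one_div]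

theorem fwdDiff_iter_shift (m q : ℕ) (f : ℕ → ℝ) (n : ℕ) :
    (fwdDiff 1)^[m] (fun i => f (i + q)) n = (fwdDiff 1)^[m] f (n + q) := by
  induction m generalizing f with
  | zero => rfl
  | succ m ih =>
    have h : fwdDiff 1 (fun i => f (i + q)) = fun i => fwdDiff 1 f (i + q) := by
      ext i
      simp only [fwdDiff]
      rw [add_right_comm]
    rw [Function.iterate_succ_apply, Function.iterate_succ_apply, ← ih, h]

theorem fwdDiff_iter_shift_sub (m q : ℕ) (f : ℕ → ℝ) (n : ℕ) :
    (fwdDiff 1)^[m] (fun i => f (i + q) - f i) n =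
      ∑ j ∈ range q, (fwdDiff 1)^[m + 1] f (n + j) := by
  have h : (fwdDiff 1)^[m] (fun i => f (i + q) - f i) n =
      (fwdDiff 1)^[m] f (n + q) - (fwdDiff 1)^[m] f n := by
    rw [← fwdDiff_iter_shift]
    have e : (fun i => f (i + q) - f i) = (fun i => f (i + q)) + (-1 : ℝ) • f := by
      ext i
      simp [sub_eq_add_neg]
    rw [e, fwdDiff_iter_add, fwdDiff_iter_const_smul]
    simp [sub_eq_add_neg]
  have h2 := Finset.sum_range_sub (fun j => (fwdDiff 1)^[m] f (n + j)) q
  rw [h]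
  simp only [add_zero] at h2
  rw [← h2]
  refine Finset.sum_congr rfl fun j _ => ?_
  rw [Function.iterate_succ_apply']
  rfl

theorem sum_inv_sqrt_le (Q : ℕ) : ∑ q ∈ Finset.Ico 1 (Q + 1), 1 / √(q : ℝ) ≤ 2 * √(Q : ℝ) := by
  induction Q with
  | zero => simp
  | succ Q ih =>
    rw [Finset.sum_Ico_succ_top (by omega)]
    have h1 : (0 : ℝ) < √((Q + 1 : ℕ) : ℝ) := Real.sqrt_pos.2 (by positivity)
    have h3 : √(Q : ℝ) * √Q = Q := Real.mul_self_sqrt (Nat.cast_nonneg _)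
    have h4 : √((Q + 1 : ℕ) : ℝ) * √((Q + 1 : ℕ) : ℝ) = Q + 1 := by
      rw [Real.mul_self_sqrt (Nat.cast_nonneg _)]; push_cast; ring
    have h5 : 1 / √((Q + 1 : ℕ) : ℝ) ≤ 2 * (√((Q + 1 : ℕ) : ℝ) - √(Q : ℝ)) := by
      rw [div_le_iff₀ h1]
      nlinarith [sq_nonneg (√((Q + 1 : ℕ) : ℝ) - √(Q : ℝ))]
    linarith

theorem sum_rpow_neg_le (Q : ℕ) {s : ℝ} (hs : s ≤ 1 / 2) :
    ∑ q ∈ Finset.Ico 1 Q, (q : ℝ) ^ (-s) ≤ 2 * Q * (Q : ℝ) ^ (-s) := by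
  rcases Nat.eq_zero_or_pos Q with rfl | hQ
  · simp
  have hQ' : (0 : ℝ) < Q := by exact_mod_cast hQ
  have h : ∀ q ∈ Finset.Ico 1 Q, (q : ℝ) ^ (-s) ≤ (Q : ℝ) ^ (1 / 2 - s) * (1 / √(q : ℝ)) := by
    intro q hq
    rw [Finset.mem_Ico] at hq
    have hq' : (0 : ℝ) < q := by exact_mod_cast hq.1
    have e : 1 / √(q : ℝ) = (q : ℝ) ^ (-(1 / 2) : ℝ) := by
      rw [Real.sqrt_eq_rpow, Real.rpow_neg hq'.le, one_div ((q : ℝ) ^ _)]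
    rw [e, show -s = (1 / 2 - s) + -(1 / 2) by ring, Real.rpow_add hq']
    gcongr
    exact hq.2.le
  refine (Finset.sum_le_sum h).trans ?_
  rw [← Finset.mul_sum]
  calc (Q : ℝ) ^ (1 / 2 - s) * ∑ q ∈ Finset.Ico 1 Q, 1 / √(q : ℝ)
      ≤ (Q : ℝ) ^ (1 / 2 - s) * (2 * √(Q : ℝ)) := by
        gcongr
        refine le_trans ?_ (sum_inv_sqrt_le Q)
        exact Finset.sum_le_sum_of_subset_of_nonneg
          (Finset.Ico_subset_Ico_right (Nat.le_succ Q)) fun _ _ _ => by positivity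
    _ = 2 * Q * (Q : ℝ) ^ (-s) := by
        have e : (Q : ℝ) * (Q : ℝ) ^ (-s) = (Q : ℝ) ^ (1 / 2 - s) * (Q : ℝ) ^ (1 / 2 : ℝ) := by
          rw [← Real.rpow_add hQ', ← Real.rpow_one_add' hQ'.le (by linarith)]
          congr 1
          ring
        rw [Real.sqrt_eq_rpow, mul_assoc 2, e]
        ring

theorem le_mul_add_of_sq_le {S D a b : ℝ} (hD : 1 ≤ D) (ha : 0 ≤ a) (hb : 0 ≤ b)
    (h : S ^ 2 ≤ D * (a ^ 2 + b ^ 2)) : S ≤ D * (a + b) := by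
  have h0 : 0 ≤ D * (a + b) := by positivity
  refine (abs_le_of_sq_le_sq' ?_ h0).2
  refine h.trans ?_
  have h1 : D * (a ^ 2 + b ^ 2) ≤ D * (a + b) ^ 2 := by gcongr; nlinarith [mul_nonneg ha hb]
  refine h1.trans ?_
  nlinarith [mul_nonneg (mul_nonneg (by linarith : 0 ≤ D) (sub_nonneg.2 hD)) (sq_nonneg (a + b))]

set_option maxHeartbeats 1000000 in
theorem DifferenceTest.succ {m : ℕ} {s t : ℝ} (hs : 0 < s) (hs2 : s ≤ 1 / 2)
    (ht1 : t ≤ 1) (h : DifferenceTest m s t) :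
    DifferenceTest (m + 1) (s / (2 + 2 * s)) (t / 2) := by
  intro C hC
  obtain ⟨B, hB, hT⟩ := h C hC
  refine ⟨8 * B + 2, by linarith, fun N f l hl h1 h2 => ?_⟩
  set u := s / (2 + 2 * s) with hu
  have hu0 : 0 < u := by positivity
  have hus : 2 * u * (1 + s) = s := by rw [hu]; field_simp
  rcases Nat.eq_zero_or_pos N with rfl | hN
  · simp only [Finset.range_zero, Finset.sum_empty, norm_zero]
    positivity
  have hN0 : (0 : ℝ) < N := by exact_mod_cast hN
  have hN1 : (1 : ℝ) ≤ N := by exact_mod_cast hN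
  have htriv : ‖∑ n ∈ range N, eC (f n)‖ ≤ N := by
    simpa using norm_sum_eC_le_card (range N) f
  have hX : 0 < (N : ℝ) * l ^ u := by positivity
  have hY : 0 < (N : ℝ) ^ (1 - t / 2) * l ^ (-u) := by positivity
  by_cases hl1 : 1 ≤ l
  · have : (1 : ℝ) ≤ l ^ u := Real.one_le_rpow hl1 hu0.le
    nlinarith
  push Not at hl1
  set L : ℝ := l ^ (-(2 * u)) with hL
  have hL1 : 1 ≤ L := Real.one_le_rpow_of_pos_of_le_one_of_nonpos hl hl1.le (by linarith)
  have hL0 : 0 < L := by linarith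
  by_cases hLN : (N : ℝ) ≤ L
  · have e : (N : ℝ) ≤ (N : ℝ) ^ (1 - t / 2) * l ^ (-u) := by
      have h3 : l ^ (-u) = L ^ (1 / 2 : ℝ) := by
        rw [hL, ← Real.rpow_mul hl.le]; congr 1; ring
      calc (N : ℝ) = (N : ℝ) ^ (1 / 2 : ℝ) * (N : ℝ) ^ (1 / 2 : ℝ) := by
            rw [← Real.rpow_add hN0]; norm_num
        _ ≤ (N : ℝ) ^ (1 - t / 2) * L ^ (1 / 2 : ℝ) := by
            gcongr
            linarith
        _ = _ := by rw [h3]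
    nlinarith
  push Not at hLN
  set Q : ℕ := ⌈L⌉₊ with hQ
  have hLQ : L ≤ Q := Nat.le_ceil L
  have hQN : Q ≤ N := Nat.ceil_le.2 hLN.le
  have hQN' : (Q : ℝ) ≤ N := by exact_mod_cast hQN
  have hQ2 : (Q : ℝ) ≤ 2 * L := by
    have := Nat.ceil_lt_add_one hL0.le
    linarith
  have hQ0 : (0 : ℝ) < Q := by linarith
  have hcorr : ∀ q ∈ Finset.Ico 1 Q,
      ‖∑ n ∈ range (N - q), inner ℂ (eC (f n)) (eC (f (n + q)))‖ ≤
        B * (N * (Q * l) ^ s + (N : ℝ) ^ (1 - t) * l ^ (-s) * (q : ℝ) ^ (-s)) := by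
    intro q hq
    rw [Finset.mem_Ico] at hq
    have hq0 : (0 : ℝ) < q := by exact_mod_cast hq.1
    have hqQ : (q : ℝ) ≤ Q := by exact_mod_cast hq.2.le
    have e : ∀ n, inner ℂ (eC (f n)) (eC (f (n + q))) = eC (f (n + q) - f n) := by
      intro n
      rw [RCLike.inner_apply, conj_eC, ← eC_add, sub_eq_add_neg]
    simp only [e]
    refine (hT (N - q) (fun n => f (n + q) - f n) (q * l) (by positivity) ?_ ?_).trans ?_
    · intro n hn
      rw [fwdDiff_iter_shift_sub]
      calc (q : ℝ) * l = ∑ j ∈ range q, l := by simp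
        _ ≤ _ := Finset.sum_le_sum fun j hj => h1 _ (by rw [Finset.mem_range] at hj; omega)
    · intro n hn
      rw [fwdDiff_iter_shift_sub]
      calc _ ≤ ∑ j ∈ range q, C * l :=
            Finset.sum_le_sum fun j hj => h2 _ (by rw [Finset.mem_range] at hj; omega)
        _ = _ := by simp; ring
    · have hNq : ((N - q : ℕ) : ℝ) ≤ N := by exact_mod_cast Nat.sub_le N q
      have e2 : ((q : ℝ) * l) ^ (-s) = l ^ (-s) * (q : ℝ) ^ (-s) := by
        rw [Real.mul_rpow hq0.le hl.le, mul_comm]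
      rw [e2, mul_assoc ((N : ℝ) ^ (1 - t))]
      gcongr
  have hvdc := van_der_corput_inequality N Q (fun n => eC (f n))
  have hsum := Finset.sum_le_sum hcorr
  have hsum2 : ∑ q ∈ Finset.Ico 1 Q,
      B * (N * (Q * l) ^ s + (N : ℝ) ^ (1 - t) * l ^ (-s) * (q : ℝ) ^ (-s)) ≤
      Q * (2 * B * (N * (L * l) ^ s + (N : ℝ) ^ (1 - t) * (L * l) ^ (-s))) := by
    rw [← Finset.mul_sum, Finset.sum_add_distrib, Finset.sum_const, nsmul_eq_mul, Nat.card_Ico,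
      ← Finset.mul_sum]
    have h3 := sum_rpow_neg_le Q hs2
    have h4 : (Q : ℝ) ^ (-s) ≤ L ^ (-s) := Real.rpow_le_rpow_of_nonpos hL0 hLQ (by linarith)
    have h5 : ((Q : ℝ) * l) ^ s ≤ 2 * (L * l) ^ s := by
      calc ((Q : ℝ) * l) ^ s ≤ (2 * (L * l)) ^ s := by
            exact Real.rpow_le_rpow (by positivity) (by nlinarith) hs.le
        _ = 2 ^ s * (L * l) ^ s := Real.mul_rpow (by norm_num) (by positivity)
        _ ≤ 2 ^ (1 : ℝ) * (L * l) ^ s := by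
            gcongr
            · norm_num
            · linarith
        _ = _ := by rw [Real.rpow_one]
    have h6 : ((Q - 1 : ℕ) : ℝ) ≤ Q := by exact_mod_cast Nat.sub_le Q 1
    have h7 : (L * l) ^ (-s) = l ^ (-s) * L ^ (-s) := by rw [mul_comm, Real.mul_rpow hl.le hL0.le]
    calc B * (((Q - 1 : ℕ) : ℝ) * (N * (Q * l) ^ s) +
          (N : ℝ) ^ (1 - t) * l ^ (-s) * ∑ q ∈ Finset.Ico 1 Q, (q : ℝ) ^ (-s))
        ≤ B * (Q * (N * (2 * (L * l) ^ s)) +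
          (N : ℝ) ^ (1 - t) * l ^ (-s) * (2 * Q * L ^ (-s))) := by
          gcongr
          exact h3.trans (by gcongr)
      _ = _ := by rw [h7]; ring
  have hz : ∑ n ∈ range N, ‖eC (f n)‖ ^ 2 = N := by simp [norm_eC]
  rw [hz] at hvdc
  have hLl : (L * l) ^ s = l ^ (2 * u) := by
    rw [hL, ← Real.rpow_add_one hl.ne', ← Real.rpow_mul hl.le]
    congr 1
    linear_combination -hus
  have hLl' : (L * l) ^ (-s) = l ^ (-(2 * u)) := by
    rw [Real.rpow_neg (by positivity), hLl, Real.rpow_neg hl.le]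
  rw [hLl, hLl'] at hsum2
  have hQL : (N : ℝ) ≤ Q * (N * l ^ (2 * u)) := by
    have : L * l ^ (2 * u) = 1 := by
      rw [hL, ← Real.rpow_add hl]; simp
    calc (N : ℝ) = L * (N * l ^ (2 * u)) := by linear_combination (-(N : ℝ)) * this
      _ ≤ _ := by gcongr
  set a : ℝ := (N : ℝ) * l ^ u with ha
  set b : ℝ := (N : ℝ) ^ (1 - t / 2) * l ^ (-u) with hb
  have haa : (N : ℝ) * (N * l ^ (2 * u)) = a ^ 2 := by
    have : l ^ (2 * u) = (l ^ u) ^ 2 := by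
      rw [← Real.rpow_natCast, ← Real.rpow_mul hl.le, mul_comm]; norm_num
    rw [this, ha]
    ring
  have hbb : (N : ℝ) * ((N : ℝ) ^ (1 - t) * l ^ (-(2 * u))) = b ^ 2 := by
    have e1 : l ^ (-(2 * u)) = (l ^ (-u)) ^ 2 := by
      rw [← Real.rpow_natCast, ← Real.rpow_mul hl.le]; congr 1; push_cast; ring
    have e2 : (N : ℝ) * (N : ℝ) ^ (1 - t) = ((N : ℝ) ^ (1 - t / 2)) ^ 2 := by
      rw [← Real.rpow_natCast, ← Real.rpow_mul hN0.le, ← Real.rpow_one_add' hN0.le (by linarith)]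
      congr 1
      push_cast
      ring
    rw [← mul_assoc, e2, e1, hb]
    ring
  have hmain : (Q : ℝ) * ‖∑ n ∈ range N, eC (f n)‖ ^ 2 ≤ Q * ((8 * B + 2) * (a ^ 2 + b ^ 2)) := by
    refine hvdc.trans ?_
    calc ((N : ℝ) + Q) * (N + 2 * ∑ q ∈ Finset.Ico 1 Q,
          ‖∑ n ∈ range (N - q), inner ℂ (eC (f n)) (eC (f (n + q)))‖)
        ≤ (2 * N) * (Q * (N * l ^ (2 * u)) +
          2 * (Q * (2 * B * (N * l ^ (2 * u) + (N : ℝ) ^ (1 - t) * l ^ (-(2 * u)))))) := by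
          gcongr
          · linarith
          · exact hsum.trans hsum2
      _ = Q * ((8 * B + 2) * a ^ 2 + 8 * B * b ^ 2) := by rw [← haa, ← hbb]; ring
      _ ≤ _ := by
          gcongr
          nlinarith [sq_nonneg b]
  have hmain2 := le_of_mul_le_mul_left hmain hQ0
  exact le_mul_add_of_sq_le (by linarith) hX.le hY.le hmain2

theorem differenceTest_four : DifferenceTest 4 (1 / 14) (1 / 4) := by
  have h := (differenceTest_two.succ (by norm_num) (by norm_num) (by norm_num)).succ
    (by norm_num) (by norm_num) (by norm_num)
  norm_num at h ⊢
  exact h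

theorem differenceTest_five : DifferenceTest 5 (1 / 30) (1 / 8) := by
  have h := differenceTest_four.succ (by norm_num) (by norm_num) (by norm_num)
  norm_num at h ⊢
  exact h

theorem differenceTest_six : DifferenceTest 6 (1 / 62) (1 / 16) := by
  have h := differenceTest_five.succ (by norm_num) (by norm_num) (by norm_num)
  norm_num at h ⊢
  exact h

/-- The mean value theorem for iterated forward differences. -/
theorem exists_fwdDiff_iter_eq (k : ℕ) (G : ℕ → ℝ → ℝ)
    (hG : ∀ i, ∀ y > 0, HasDerivAt (G i) (G (i + 1) y) y) (x : ℝ) (hx : 0 < x) :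
    ∃ ξ, x ≤ ξ ∧ ξ ≤ x + k ∧ (fwdDiff 1)^[k] (G 0) x = G k ξ := by
  induction k generalizing G with
  | zero => exact ⟨x, le_rfl, by simp, rfl⟩
  | succ k ih =>
    obtain ⟨ξ, h1, h2, h3⟩ := ih (fun i => fwdDiff 1 (G i)) (fun i y hy => by
      simp only [fwdDiff]
      exact (HasDerivAt.comp_add_const y 1 (hG i (y + 1) (by linarith))).sub (hG i y hy))
    obtain ⟨ζ, hζ, h4⟩ := exists_hasDerivAt_eq_slope (G k) (G (k + 1)) (lt_add_one ξ)
      (fun y hy => (hG k y (by linarith [hy.1])).continuousAt.continuousWithinAt)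
      (fun y hy => hG k y (by linarith [hy.1]))
    refine ⟨ζ, by linarith [hζ.1], by push_cast; linarith [hζ.2], ?_⟩
    rw [Function.iterate_succ_apply, h3, h4]
    simp [fwdDiff]

theorem hasDerivAt_prod_mul_rpow (c : ℝ) (i : ℕ) (y : ℝ) (hy : 0 < y) :
    HasDerivAt (fun z : ℝ => (∏ j ∈ range i, (c - j)) * z ^ (c - i))
      ((∏ j ∈ range (i + 1), (c - j)) * y ^ (c - (i + 1 : ℕ))) y := by
  have h := (Real.hasDerivAt_rpow_const (p := c - i) (Or.inl hy.ne')).const_mul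
    (∏ j ∈ range i, (c - (j : ℝ)))
  refine h.congr_deriv ?_
  rw [Finset.prod_range_succ, show c - ((i + 1 : ℕ) : ℝ) = c - i - 1 by push_cast; ring]
  ring

theorem exists_fwdDiff_iter_rpow (c : ℝ) (k : ℕ) (x : ℝ) (hx : 0 < x) :
    ∃ ξ, x ≤ ξ ∧ ξ ≤ x + k ∧
      (fwdDiff 1)^[k] (fun z : ℝ => z ^ c) x = (∏ j ∈ range k, (c - j)) * ξ ^ (c - k) := by
  have h := exists_fwdDiff_iter_eq k
    (fun i z => (∏ j ∈ range i, (c - (j : ℝ))) * z ^ (c - i))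
    (fun i y hy => hasDerivAt_prod_mul_rpow c i y hy) x hx
  simpa using h

theorem fwdDiff_iter_comp_natCast (k : ℕ) (F : ℝ → ℝ) (x : ℝ) (n : ℕ) :
    (fwdDiff 1)^[k] (fun i : ℕ => F (x + i)) n = (fwdDiff 1)^[k] F (x + n) := by
  induction k generalizing F with
  | zero => rfl
  | succ k ih =>
    have h : fwdDiff 1 (fun i : ℕ => F (x + i)) = fun i : ℕ => fwdDiff 1 F (x + i) := by
      ext i
      simp only [fwdDiff]
      push_cast
      rw [add_assoc]
    rw [Function.iterate_succ_apply, Function.iterate_succ_apply, ← ih, h]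

theorem sum_Ioc_floor_eq (Y : ℝ) (g : ℕ → ℂ) :
    ∑ n ∈ Finset.Ioc ⌊Y⌋₊ ⌊2 * Y⌋₊, g n =
      ∑ i ∈ range (⌊2 * Y⌋₊ - ⌊Y⌋₊), g (⌊Y⌋₊ + 1 + i) := by
  rw [← Finset.Ico_add_one_add_one_eq_Ioc, Finset.sum_Ico_eq_sum_range]
  simp

theorem card_dyadic_le {Y : ℝ} (hY : 1 ≤ Y) : ((⌊2 * Y⌋₊ - ⌊Y⌋₊ : ℕ) : ℝ) ≤ 2 * Y := by
  have h1 : ((⌊2 * Y⌋₊ - ⌊Y⌋₊ : ℕ) : ℝ) ≤ (⌊2 * Y⌋₊ : ℝ) := by exact_mod_cast Nat.sub_le _ _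
  exact h1.trans (Nat.floor_le (by linarith))

/-- The derivative test for dyadic sums with phase `γ n ^ c`. -/
theorem DifferenceTest.rpow_sum {k : ℕ} {s t : ℝ} (h : DifferenceTest k s t) (ht0 : 0 ≤ t)
    (ht : t ≤ 1) {c : ℝ}
    (hck : c ≤ k) (hc : ∀ j < k, c ≠ j) :
    ∃ B > 0, ∀ γ Y : ℝ, γ ≠ 0 → 1 ≤ Y →
      ‖∑ n ∈ Finset.Ioc ⌊Y⌋₊ ⌊2 * Y⌋₊, eC (γ * (n : ℝ) ^ c)‖ ≤
        B * (Y * (|γ| * Y ^ (c - k)) ^ s + Y ^ (1 - t) * (|γ| * Y ^ (c - k)) ^ (-s)) := by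
  set p : ℝ := ∏ j ∈ range k, (c - (j : ℝ)) with hp
  have hp0 : p ≠ 0 := by
    rw [hp, Finset.prod_ne_zero_iff]
    exact fun j hj => sub_ne_zero.2 (hc j (Finset.mem_range.1 hj))
  set R : ℝ := 4 + k with hR
  have hR1 : 1 ≤ R := by rw [hR]; linarith [(Nat.cast_nonneg k : (0 : ℝ) ≤ k)]
  have hR0 : 0 < R := by linarith
  set b : ℝ := |p| * R ^ (c - k) with hb
  have hb0 : 0 < b := by positivity
  obtain ⟨B, hB, hT⟩ := h (R ^ (k - c)) (Real.one_le_rpow hR1 (by linarith))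
  refine ⟨B * (2 * b ^ s + 2 * b ^ (-s)), by positivity, ?_⟩
  have key : ∀ γ Y : ℝ, 0 < γ * p → 1 ≤ Y →
      ‖∑ n ∈ Finset.Ioc ⌊Y⌋₊ ⌊2 * Y⌋₊, eC (γ * (n : ℝ) ^ c)‖ ≤
        B * (2 * b ^ s + 2 * b ^ (-s)) *
          (Y * (|γ| * Y ^ (c - k)) ^ s + Y ^ (1 - t) * (|γ| * Y ^ (c - k)) ^ (-s)) := by
    intro γ Y hγ hY
    have hY0 : 0 < Y := by linarith
    have hγ0 : γ ≠ 0 := fun h0 => by simp [h0] at hγ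
    have habs : γ * p = |p| * |γ| := by rw [← abs_of_pos hγ, abs_mul, mul_comm]
    set l : ℝ := |γ| * Y ^ (c - k) with hl
    have hl0 : 0 < l := by positivity
    rw [sum_Ioc_floor_eq]
    set N := ⌊2 * Y⌋₊ - ⌊Y⌋₊ with hN
    set x : ℝ := ⌊Y⌋₊ + 1 with hx
    have hxY : Y ≤ x := (Nat.lt_floor_add_one Y).le
    have hxY2 : x ≤ Y + 1 := by rw [hx]; linarith [Nat.floor_le hY0.le]
    have hdiff : ∀ n < N, ∃ ξ, Y ≤ ξ ∧ ξ ≤ R * Y ∧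
        (fwdDiff 1)^[k] (fun i : ℕ => γ * ((⌊Y⌋₊ + 1 + i : ℕ) : ℝ) ^ c) n =
          |p| * |γ| * ξ ^ (c - k) := by
      intro n hn
      obtain ⟨ξ, h1, h2, h3⟩ := exists_fwdDiff_iter_rpow c k (x + n) (by positivity)
      have hn' : (n : ℝ) ≤ 2 * Y :=
        le_trans (by exact_mod_cast hn.le) (card_dyadic_le hY)
      refine ⟨ξ, ?_, ?_, ?_⟩
      · linarith [(Nat.cast_nonneg n : (0 : ℝ) ≤ n)]
      · have : (k : ℝ) ≤ k * Y := le_mul_of_one_le_right (Nat.cast_nonneg _) hY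
        rw [hR]
        linarith
      · have e : (fun i : ℕ => γ * ((⌊Y⌋₊ + 1 + i : ℕ) : ℝ) ^ c) =
            γ • (fun i : ℕ => (fun z : ℝ => z ^ c) (x + i)) := by
          ext i
          simp [hx]
        rw [e, fwdDiff_iter_const_smul, Pi.smul_apply,
          fwdDiff_iter_comp_natCast k (fun z : ℝ => z ^ c) x n, h3, smul_eq_mul,
          ← mul_assoc, habs]
    have hest := hT N (fun i : ℕ => γ * ((⌊Y⌋₊ + 1 + i : ℕ) : ℝ) ^ c) (b * l) (by positivity)
      (fun n hn => by
        obtain ⟨ξ, h1, h2, h3⟩ := hdiff n hn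
        rw [h3]
        have : (R * Y) ^ (c - k) ≤ ξ ^ (c - k) :=
          Real.rpow_le_rpow_of_nonpos (by linarith) h2 (by linarith)
        rw [Real.mul_rpow hR0.le hY0.le] at this
        calc b * l = |p| * |γ| * (R ^ (c - k) * Y ^ (c - k)) := by rw [hb, hl]; ring
          _ ≤ _ := by gcongr)
      (fun n hn => by
        obtain ⟨ξ, h1, h2, h3⟩ := hdiff n hn
        rw [h3]
        have h4 : ξ ^ (c - k) ≤ Y ^ (c - k) :=
          Real.rpow_le_rpow_of_nonpos hY0 h1 (by linarith)
        have h5 : R ^ (k - c) * R ^ (c - k) = 1 := by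
          rw [← Real.rpow_add hR0]; simp
        calc |p| * |γ| * ξ ^ (c - k) ≤ |p| * |γ| * Y ^ (c - k) := by gcongr
          _ = R ^ (k - c) * (b * l) := by
            rw [hb, hl]
            linear_combination (-(|p| * |γ| * Y ^ (c - k))) * h5)
    refine hest.trans ?_
    have hN2 : (N : ℝ) ≤ 2 * Y := card_dyadic_le hY
    have hN3 : (N : ℝ) ^ (1 - t) ≤ 2 * Y ^ (1 - t) := by
      calc (N : ℝ) ^ (1 - t) ≤ (2 * Y) ^ (1 - t) :=
            Real.rpow_le_rpow (Nat.cast_nonneg _) hN2 (by linarith)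
        _ = 2 ^ (1 - t) * Y ^ (1 - t) := Real.mul_rpow (by norm_num) hY0.le
        _ ≤ 2 ^ (1 : ℝ) * Y ^ (1 - t) := by
            gcongr
            · norm_num
            · linarith
        _ = _ := by rw [Real.rpow_one]
    have hb1 : 0 < b ^ s := by positivity
    have hb2 : 0 < b ^ (-s) := by positivity
    have hl1 : 0 < Y * l ^ s := by positivity
    have hl2 : 0 < Y ^ (1 - t) * l ^ (-s) := by positivity
    rw [Real.mul_rpow hb0.le hl0.le, Real.mul_rpow hb0.le hl0.le, mul_assoc B]
    calc B * (N * (b ^ s * l ^ s) + (N : ℝ) ^ (1 - t) * (b ^ (-s) * l ^ (-s)))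
        ≤ B * (2 * Y * (b ^ s * l ^ s) + 2 * Y ^ (1 - t) * (b ^ (-s) * l ^ (-s))) := by gcongr
      _ = B * (2 * b ^ s * (Y * l ^ s) + 2 * b ^ (-s) * (Y ^ (1 - t) * l ^ (-s))) := by ring
      _ ≤ _ := by
        gcongr
        nlinarith [mul_pos hb1 hl2, mul_pos hb2 hl1]
  intro γ Y hγ hY
  rcases lt_or_gt_of_ne (mul_ne_zero hγ hp0) with hneg | hpos
  · have := key (-γ) Y (by linarith) hY
    rw [abs_neg] at this
    refine le_trans (le_of_eq ?_) this
    rw [← norm_sum_eC_neg]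
    simp only [neg_mul]
  · exact key γ Y hpos hY

/-- Cauchy's inequality followed by Weyl differencing in the smooth variable of a bilinear sum. -/
theorem bilinear_weyl_differencing (I : Finset ℕ) (N Q : ℕ) (f : ℕ → ℕ → ℝ) (a : ℕ → ℂ)
    {a₀ T : ℝ} (hT0 : 0 ≤ T) (ha : ∀ m ∈ I, ‖a m‖ ≤ a₀)
    (hT : ∀ q ∈ Finset.Ico 1 Q, ∀ n ∈ range (N - q),
      ‖∑ m ∈ I, eC (f m (n + q) - f m n)‖ ≤ T) :
    Q * ‖∑ m ∈ I, a m * ∑ n ∈ range N, eC (f m n)‖ ^ 2 ≤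
      a₀ ^ 2 * #I * ((N + Q) * (N * #I + 2 * (Q * (N * T)))) := by
  let z : ℕ → EuclideanSpace ℂ I := fun n => WithLp.toLp 2 fun m => eC (f m n)
  have hz : ∀ n, ‖z n‖ ^ 2 = #I := by
    intro n
    simp [z, EuclideanSpace.norm_sq_eq, norm_eC]
  have hinner : ∀ n q, inner ℂ (z n) (z (n + q)) = ∑ m ∈ I, eC (f m (n + q) - f m n) := by
    intro n q
    rw [← Finset.sum_coe_sort I]
    simp [z, PiLp.inner_apply, conj_eC, ← eC_add, sub_eq_add_neg]
  have hcorr : ∑ q ∈ Finset.Ico 1 Q, ‖∑ n ∈ range (N - q), inner ℂ (z n) (z (n + q))‖ ≤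
      Q * (N * T) := by
    have hq : ∀ q ∈ Finset.Ico 1 Q,
        ‖∑ n ∈ range (N - q), inner ℂ (z n) (z (n + q))‖ ≤ N * T := by
      intro q hq
      refine (norm_sum_le_of_le _ fun n hn => (hinner n q ▸ hT q hq n hn)).trans ?_
      rw [sum_const, card_range, nsmul_eq_mul]
      gcongr
      exact Nat.sub_le _ _
    refine (sum_le_card_nsmul _ _ _ hq).trans ?_
    rw [Nat.card_Ico, nsmul_eq_mul]
    gcongr
    exact Nat.sub_le _ _
  have hvdc := van_der_corput_inequality N Q z
  rw [Finset.sum_congr rfl fun n _ => hz n, sum_const, card_range, nsmul_eq_mul] at hvdc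
  have hnorm : ‖∑ n ∈ range N, z n‖ ^ 2 = ∑ m ∈ I, ‖∑ n ∈ range N, eC (f m n)‖ ^ 2 := by
    rw [EuclideanSpace.norm_sq_eq, ← Finset.sum_coe_sort I]
    simp [z, WithLp.ofLp_sum]
  have ha2 : ∑ m ∈ I, ‖a m‖ ^ 2 ≤ a₀ ^ 2 * #I := by
    refine (sum_le_card_nsmul _ _ (a₀ ^ 2) fun m hm => ?_).trans (by rw [nsmul_eq_mul, mul_comm])
    exact pow_le_pow_left₀ (norm_nonneg _) (ha m hm) 2
  have hcs : ‖∑ m ∈ I, a m * ∑ n ∈ range N, eC (f m n)‖ ^ 2 ≤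
      a₀ ^ 2 * #I * ‖∑ n ∈ range N, z n‖ ^ 2 := by
    calc ‖∑ m ∈ I, a m * ∑ n ∈ range N, eC (f m n)‖ ^ 2
        ≤ (∑ m ∈ I, ‖a m‖ * ‖∑ n ∈ range N, eC (f m n)‖) ^ 2 := by
          gcongr
          exact norm_sum_le_of_le _ fun m _ => norm_mul_le _ _
      _ ≤ (∑ m ∈ I, ‖a m‖ ^ 2) * ∑ m ∈ I, ‖∑ n ∈ range N, eC (f m n)‖ ^ 2 :=
          sum_mul_sq_le_sq_mul_sq _ _ _
      _ ≤ _ := by rw [hnorm]; gcongr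
  calc Q * ‖∑ m ∈ I, a m * ∑ n ∈ range N, eC (f m n)‖ ^ 2
      ≤ a₀ ^ 2 * #I * (Q * ‖∑ n ∈ range N, z n‖ ^ 2) := by
        calc _ ≤ Q * (a₀ ^ 2 * #I * ‖∑ n ∈ range N, z n‖ ^ 2) := by gcongr
          _ = _ := by ring
    _ ≤ _ := by
        refine mul_le_mul_of_nonneg_left (hvdc.trans ?_) (by positivity)
        gcongr

/-- The finite difference of `x ^ c` over a step `q` inside `[Y, 2 Y]`. -/
theorem rpow_add_sub_rpow_mem {c Y x q : ℝ} (hc : 1 ≤ c) (hY : 0 < Y) (hx : Y ≤ x) (hq : 0 < q)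
    (hxq : x + q ≤ 2 * Y) :
    c * Y ^ (c - 1) * q ≤ (x + q) ^ c - x ^ c ∧
      (x + q) ^ c - x ^ c ≤ c * (2 * Y) ^ (c - 1) * q := by
  obtain ⟨ξ, hξ, h⟩ := exists_hasDerivAt_eq_slope (fun y : ℝ => y ^ c)
    (fun y => c * y ^ (c - 1)) (show x < x + q by linarith)
    (continuousOn_id.rpow_const fun y _ => Or.inr (by linarith))
    fun y hy => Real.hasDerivAt_rpow_const (Or.inl (by linarith [hy.1]))
  have h' : (x + q) ^ c - x ^ c = c * ξ ^ (c - 1) * q := by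
    rw [h, add_sub_cancel_left, div_mul_cancel₀ _ hq.ne']
  rw [h']
  have h1 : Y ≤ ξ := by linarith [hξ.1]
  have h2 : ξ ≤ 2 * Y := by linarith [hξ.2]
  have h3 : 0 ≤ c - 1 := by linarith
  have h4 : 0 < ξ := by linarith
  constructor <;> gcongr

/-- A smooth sum saves a power of `X` when `|β| X ^ c` has suitable size compared with `K`. -/
theorem DifferenceTest.dilated_rpow_sum {k : ℕ} {s t : ℝ} (h : DifferenceTest k s t)
    (hs : 0 ≤ s) (ht0 : 0 ≤ t) (ht : t ≤ 1) (hst : t ≤ k * s) {c : ℝ} (hc0 : 0 ≤ c) (hck : c ≤ k)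
    (hc : ∀ j < k, c ≠ j) {A : ℝ} (hA : 0 < A) {κ₁ κ₂ φ₁ φ₂ σ : ℝ} (hκ : 0 ≤ κ₁)
    (h1 : σ ≤ (k * κ₁ - φ₂) * s) (h2 : σ ≤ φ₁ * s - (k * s - t) * κ₂) :
    ∃ C > 0, ∀ X M K β : ℝ, 1 ≤ X → A⁻¹ * X ≤ M * K → M * K ≤ A * X →
      X ^ κ₁ ≤ K → K ≤ X ^ κ₂ → X ^ φ₁ ≤ |β| * X ^ c → |β| * X ^ c ≤ X ^ φ₂ →
      ∀ m ∈ Finset.Ioc ⌊M⌋₊ ⌊2 * M⌋₊,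
        ‖∑ k ∈ Finset.Ioc ⌊K⌋₊ ⌊2 * K⌋₊, eC (β * ((m * k : ℕ) : ℝ) ^ c)‖ ≤
          C * K * X ^ (-σ) := by
  obtain ⟨B, hB, hsum⟩ := h.rpow_sum ht0 ht hck hc
  refine ⟨B * (((2 * A) ^ c) ^ s + (A⁻¹ ^ c) ^ (-s)), by positivity, ?_⟩
  intro X M K β hX hMK1 hMK2 hK1 hK2 hF1 hF2 m hm
  have hX0 : 0 < X := by linarith
  have hK : 1 ≤ K := (Real.one_le_rpow hX hκ).trans hK1
  have hK0 : 0 < K := by linarith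
  have hM0 : 0 < M := pos_of_mul_pos_left ((by positivity : 0 < A⁻¹ * X).trans_le hMK1) hK0.le
  rw [Finset.mem_Ioc] at hm
  have hm1 : M ≤ m := (Nat.lt_of_floor_lt hm.1).le
  have hm2 : (m : ℝ) ≤ 2 * M := (Nat.le_floor_iff (by positivity)).1 hm.2
  have hm0 : (0 : ℝ) < m := by linarith
  have hβ : 0 < |β| := by
    have := (Real.rpow_pos_of_pos hX0 φ₁).trans_le hF1
    exact pos_of_mul_pos_left this (by positivity)
  have hβ0 : β ≠ 0 := abs_pos.1 hβ
  have hs' := hsum (β * (m : ℝ) ^ c) K (by positivity) hK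
  have e : ∀ n : ℕ, eC (β * ((m * n : ℕ) : ℝ) ^ c) = eC (β * (m : ℝ) ^ c * (n : ℝ) ^ c) := by
    intro n
    rw [Nat.cast_mul, Real.mul_rpow (by positivity) (by positivity), mul_assoc]
  rw [Finset.sum_congr rfl fun n _ => e n]
  refine hs'.trans ?_
  have habs : |β * (m : ℝ) ^ c| * K ^ (c - k) = |β| * (m * K) ^ c * K ^ (-k : ℝ) := by
    rw [abs_mul, abs_of_pos (by positivity : 0 < (m : ℝ) ^ c),
      Real.mul_rpow (by positivity) (by positivity), sub_eq_add_neg, Real.rpow_add hK0]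
    ring
  rw [habs]
  have hmK1 : A⁻¹ * X ≤ m * K := hMK1.trans (by gcongr)
  have hmK2 : m * K ≤ 2 * A * X := by
    calc m * K ≤ 2 * M * K := by gcongr
      _ ≤ 2 * A * X := by linarith
  set l := |β| * (m * K) ^ c * K ^ (-k : ℝ) with hl
  have hl0 : 0 < l := by positivity
  have hu : l ≤ (2 * A) ^ c * X ^ (φ₂ - k * κ₁) := by
    calc l ≤ |β| * (2 * A * X) ^ c * (X ^ κ₁) ^ (-k : ℝ) := by
          rw [hl]
          have := Real.rpow_le_rpow_of_nonpos (by positivity) hK1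
            (by simp : -(k : ℝ) ≤ 0)
          gcongr
      _ = (2 * A) ^ c * (|β| * X ^ c) * X ^ (-(k * κ₁)) := by
          rw [Real.mul_rpow (by positivity) hX0.le, ← Real.rpow_mul hX0.le]
          ring_nf
      _ ≤ (2 * A) ^ c * X ^ φ₂ * X ^ (-(k * κ₁)) := by gcongr
      _ = _ := by rw [sub_eq_add_neg, Real.rpow_add hX0]; ring
  have hlow : A⁻¹ ^ c * X ^ φ₁ * K ^ (-k : ℝ) ≤ l := by
    calc A⁻¹ ^ c * X ^ φ₁ * K ^ (-k : ℝ) ≤ A⁻¹ ^ c * (|β| * X ^ c) * K ^ (-k : ℝ) := by gcongr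
      _ = |β| * (A⁻¹ * X) ^ c * K ^ (-k : ℝ) := by
          rw [Real.mul_rpow (by positivity) hX0.le]; ring
      _ ≤ l := by rw [hl]; gcongr
  have hb1 : l ^ s ≤ ((2 * A) ^ c) ^ s * X ^ (-σ) := by
    calc l ^ s ≤ ((2 * A) ^ c * X ^ (φ₂ - k * κ₁)) ^ s := by gcongr
      _ = ((2 * A) ^ c) ^ s * X ^ ((φ₂ - k * κ₁) * s) := by
          rw [Real.mul_rpow (by positivity) (by positivity), ← Real.rpow_mul hX0.le]
      _ ≤ _ := by
          gcongr
          linarith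
  have hb2 : K ^ (1 - t) * l ^ (-s) ≤ (A⁻¹ ^ c) ^ (-s) * K * X ^ (-σ) := by
    calc K ^ (1 - t) * l ^ (-s)
        ≤ K ^ (1 - t) * (A⁻¹ ^ c * X ^ φ₁ * K ^ (-k : ℝ)) ^ (-s) := by
          gcongr ?_ * ?_
          exact Real.rpow_le_rpow_of_nonpos (by positivity) hlow (by linarith)
      _ = (A⁻¹ ^ c) ^ (-s) * X ^ (-(φ₁ * s)) * (K * K ^ (k * s - t)) := by
          rw [Real.mul_rpow (by positivity) (by positivity),
            Real.mul_rpow (by positivity) (by positivity), ← Real.rpow_mul hX0.le,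
            ← Real.rpow_mul hK0.le,
            show K * K ^ (k * s - t) = K ^ (1 - t) * K ^ (-(k : ℝ) * -s) by
              rw [← Real.rpow_add hK0, ← Real.rpow_one_add' hK0.le (by nlinarith)]
              ring_nf]
          ring_nf
      _ ≤ (A⁻¹ ^ c) ^ (-s) * X ^ (-(φ₁ * s)) * (K * (X ^ κ₂) ^ (k * s - t)) := by
          have : 0 ≤ k * s - t := by linarith
          gcongr
      _ = (A⁻¹ ^ c) ^ (-s) * K * X ^ (-(φ₁ * s) + (k * s - t) * κ₂) := by
          rw [← Real.rpow_mul hX0.le, Real.rpow_add hX0]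
          ring_nf
      _ ≤ _ := by
          gcongr
          linarith
  calc B * (K * l ^ s + K ^ (1 - t) * l ^ (-s))
      ≤ B * (K * (((2 * A) ^ c) ^ s * X ^ (-σ)) + (A⁻¹ ^ c) ^ (-s) * K * X ^ (-σ)) := by gcongr
    _ = _ := by ring

/-- The bilinear sum when both variables are close to `X ^ (1 / 2)`. -/
theorem norm_bilinear_rpow_sum_le {c : ℝ} (hc1 : 1 < c) (hc3 : c < 3) (hc2 : c ≠ 2) {A : ℝ}
    (hA : 0 < A) :
    ∃ C > 0, ∀ X M K β a₀ : ℝ, 1 ≤ X → A⁻¹ * X ≤ M * K → M * K ≤ A * X →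
      1 ≤ K → K ≤ X ^ (0.4966 : ℝ) → X ^ (0.5033 : ℝ) ≤ M → M ≤ X ^ (0.5146 : ℝ) →
      X ^ (1.98 : ℝ) ≤ |β| * X ^ c → |β| * X ^ c ≤ X ^ (2.0697 : ℝ) → X ^ (0.03 : ℝ) ≤ K →
      ∀ a : ℕ → ℂ, (∀ m ∈ Finset.Ioc ⌊M⌋₊ ⌊2 * M⌋₊, ‖a m‖ ≤ a₀) →
        ‖∑ m ∈ Finset.Ioc ⌊M⌋₊ ⌊2 * M⌋₊, a m *
          ∑ k ∈ Finset.Ioc ⌊K⌋₊ ⌊2 * K⌋₊, eC (β * ((m * k : ℕ) : ℝ) ^ c)‖ ^ 2 ≤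
          C * a₀ ^ 2 * (M * K) ^ 2 * X ^ (-0.02924 : ℝ) := by
  obtain ⟨B, hB, hsum⟩ := differenceTest_four.rpow_sum (c := c) (by norm_num) (by norm_num)
    (by push_cast; linarith) (by
      intro j hj
      interval_cases j <;> norm_num <;> first | exact hc2 | linarith)
  set C₁ : ℝ := 2 * c * 2 ^ (c - 1) * A ^ c * A with hC₁
  set C₂ : ℝ := c * A⁻¹ ^ c with hC₂
  set D : ℝ := B * (C₁ ^ (1 / 14 : ℝ) + C₂ ^ (-(1 / 14) : ℝ)) with hD
  have hC₁0 : 0 < C₁ := by positivity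
  have hC₂0 : 0 < C₂ := by positivity
  have hD0 : 0 < D := by positivity
  refine ⟨2 * 4 * (2 * 2 + 2 * (2 * D)), by positivity, ?_⟩
  intro X M K β a₀ hX hMK1 hMK2 hK hK2 hM1 hM2 hF1 hF2 hKQ a ha
  have hX0 : 0 < X := by linarith
  have hK0 : 0 < K := by linarith
  have hM : 1 ≤ M := (Real.one_le_rpow hX (by norm_num)).trans hM1
  have hM0 : 0 < M := by linarith
  have hβ : 0 < |β| :=
    pos_of_mul_pos_left ((Real.rpow_pos_of_pos hX0 _).trans_le hF1) (by positivity)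
  set Q := ⌈X ^ (0.03 : ℝ)⌉₊ with hQ
  have hQ1 : X ^ (0.03 : ℝ) ≤ Q := Nat.le_ceil _
  have hX3 : 1 ≤ X ^ (0.03 : ℝ) := Real.one_le_rpow hX (by norm_num)
  have hQ2 : (Q : ℝ) ≤ 2 * X ^ (0.03 : ℝ) := by
    have := Nat.ceil_lt_add_one (by positivity : 0 ≤ X ^ (0.03 : ℝ))
    rw [← hQ] at this
    linarith
  have hQ0 : (0 : ℝ) < Q := by linarith
  set N := ⌊2 * K⌋₊ - ⌊K⌋₊ with hN
  have hN2 : (N : ℝ) ≤ 2 * K := card_dyadic_le hK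
  set I := Finset.Ioc ⌊M⌋₊ ⌊2 * M⌋₊ with hI
  have hcard : (#I : ℝ) ≤ 2 * M := by
    rw [hI, Nat.card_Ioc]
    exact card_dyadic_le hM
  set T : ℝ := D * M * X ^ (-0.02924 : ℝ) with hT
  have hT0 : 0 < T := by positivity
  have hcorr : ∀ q ∈ Finset.Ico 1 Q, ∀ n ∈ range (N - q),
      ‖∑ m ∈ I, eC (β * ((m * (⌊K⌋₊ + 1 + (n + q)) : ℕ) : ℝ) ^ c -
        β * ((m * (⌊K⌋₊ + 1 + n) : ℕ) : ℝ) ^ c)‖ ≤ T := by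
    intro q hq n hn
    rw [Finset.mem_Ico] at hq
    rw [Finset.mem_range] at hn
    have hq1 : (1 : ℝ) ≤ q := by exact_mod_cast hq.1
    have hqQ : (q : ℝ) ≤ Q := by exact_mod_cast hq.2.le
    set x : ℝ := ((⌊K⌋₊ + 1 + n : ℕ) : ℝ) with hx
    have hKx : K ≤ x := by
      rw [hx]
      push_cast
      linarith [(Nat.lt_floor_add_one K).le, (Nat.cast_nonneg n : (0 : ℝ) ≤ n)]
    have hxq : x + q ≤ 2 * K := by
      rw [hx, ← Nat.cast_add]
      exact (Nat.le_floor_iff (by positivity)).1 (by omega)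
    obtain ⟨hd1, hd2⟩ := rpow_add_sub_rpow_mem hc1.le hK0 hKx (by linarith : (0 : ℝ) < q) hxq
    set d := (x + q) ^ c - x ^ c with hd
    have hd0 : 0 < d := lt_of_lt_of_le (by positivity) hd1
    have hphase : ∀ m : ℕ, β * ((m * (⌊K⌋₊ + 1 + (n + q)) : ℕ) : ℝ) ^ c -
        β * ((m * (⌊K⌋₊ + 1 + n) : ℕ) : ℝ) ^ c = β * d * (m : ℝ) ^ c := by
      intro m
      have hxq' : ((⌊K⌋₊ + 1 + (n + q) : ℕ) : ℝ) = x + q := by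
        rw [hx]; push_cast; ring
      rw [Nat.cast_mul, Nat.cast_mul, hxq', Real.mul_rpow (by positivity) (by positivity),
        Real.mul_rpow (by positivity) (by positivity), hd]
      ring
    rw [Finset.sum_congr rfl fun m _ => congrArg eC (hphase m)]
    refine (hsum (β * d) M (mul_ne_zero (abs_pos.1 hβ) hd0.ne') hM).trans ?_
    rw [abs_mul, abs_of_pos hd0]
    push_cast
    set l := |β| * d * M ^ (c - 4) with hl
    have hl0 : 0 < l := by positivity
    have hsplit : K ^ (c - 1) * M ^ (c - 4) = (M * K) ^ c * (K⁻¹ * M ^ (-4 : ℝ)) := by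
      rw [Real.mul_rpow hM0.le hK0.le, sub_eq_add_neg, sub_eq_add_neg, Real.rpow_add hK0,
        Real.rpow_add hM0, Real.rpow_neg_one]
      ring
    have hu : l ≤ C₁ * X ^ (-0.4102 : ℝ) := by
      have hKM : K⁻¹ * M ^ (-4 : ℝ) ≤ A * X ^ (-2.5099 : ℝ) := by
        have h1 : K⁻¹ * M⁻¹ ≤ A * X ^ (-1 : ℝ) := by
          rw [Real.rpow_neg_one, ← mul_inv, mul_comm K, ← inv_inv A, ← mul_inv]
          exact inv_anti₀ (by positivity) hMK1
        have h2 : M ^ (-3 : ℝ) ≤ X ^ (-1.5099 : ℝ) := by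
          calc M ^ (-3 : ℝ) ≤ (X ^ (0.5033 : ℝ)) ^ (-3 : ℝ) :=
                Real.rpow_le_rpow_of_nonpos (by positivity) hM1 (by norm_num)
            _ = _ := by rw [← Real.rpow_mul hX0.le]; norm_num
        calc K⁻¹ * M ^ (-4 : ℝ) = K⁻¹ * M⁻¹ * M ^ (-3 : ℝ) := by
              rw [← Real.rpow_neg_one M, mul_assoc, ← Real.rpow_add hM0]
              norm_num
          _ ≤ A * X ^ (-1 : ℝ) * X ^ (-1.5099 : ℝ) := by gcongr
          _ = _ := by rw [mul_assoc, ← Real.rpow_add hX0]; norm_num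
      calc l ≤ |β| * (c * (2 * K) ^ (c - 1) * (2 * X ^ (0.03 : ℝ))) * M ^ (c - 4) := by
            rw [hl]
            gcongr
            refine hd2.trans ?_
            gcongr
            exact hqQ.trans hQ2
        _ = 2 * c * 2 ^ (c - 1) * X ^ (0.03 : ℝ) * (|β| * (M * K) ^ c) *
            (K⁻¹ * M ^ (-4 : ℝ)) := by
            rw [Real.mul_rpow (by norm_num) hK0.le]
            linear_combination (|β| * c * 2 ^ (c - 1) * (2 * X ^ (0.03 : ℝ))) * hsplit
        _ ≤ 2 * c * 2 ^ (c - 1) * X ^ (0.03 : ℝ) * (|β| * (A * X) ^ c) *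
            (A * X ^ (-2.5099 : ℝ)) := by gcongr
        _ = C₁ * (|β| * X ^ c) * (X ^ (0.03 : ℝ) * X ^ (-2.5099 : ℝ)) := by
            rw [Real.mul_rpow hA.le hX0.le, hC₁]; ring
        _ ≤ C₁ * X ^ (2.0697 : ℝ) * (X ^ (0.03 : ℝ) * X ^ (-2.5099 : ℝ)) := by gcongr
        _ = _ := by
            rw [mul_assoc, ← Real.rpow_add hX0, ← Real.rpow_add hX0]; norm_num
    have hlow : C₂ * X ^ (1.2261 : ℝ) * M ^ (-3.5 : ℝ) ≤ l := by
      calc C₂ * X ^ (1.2261 : ℝ) * M ^ (-3.5 : ℝ)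
          = C₂ * X ^ (1.98 : ℝ) * ((X ^ (0.4966 : ℝ))⁻¹ *
              ((X ^ (0.5146 : ℝ)) ^ (-0.5 : ℝ) * M ^ (-3.5 : ℝ))) := by
            rw [show (1.2261 : ℝ) = 1.98 + -0.4966 + 0.5146 * -0.5 by norm_num,
              Real.rpow_add hX0, Real.rpow_add hX0, Real.rpow_mul hX0.le, Real.rpow_neg hX0.le]
            ring
        _ ≤ C₂ * (|β| * X ^ c) * (K⁻¹ * (M ^ (-0.5 : ℝ) * M ^ (-3.5 : ℝ))) := by
            have := Real.rpow_le_rpow_of_nonpos hM0 hM2 (by norm_num : (-0.5 : ℝ) ≤ 0)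
            gcongr
        _ = |β| * c * (A⁻¹ * X) ^ c * (K⁻¹ * M ^ (-4 : ℝ)) := by
            rw [← Real.rpow_add hM0, Real.mul_rpow (by positivity) hX0.le, hC₂,
              show (-0.5 + -3.5 : ℝ) = -4 by norm_num]
            ring
        _ ≤ |β| * c * (M * K) ^ c * (K⁻¹ * M ^ (-4 : ℝ)) := by gcongr
        _ = |β| * (c * K ^ (c - 1) * 1) * M ^ (c - 4) := by
            linear_combination (-(|β| * c)) * hsplit
        _ ≤ l := by
            rw [hl]
            gcongr
            refine le_trans ?_ hd1
            gcongr
    have hb1 : l ^ (1 / 14 : ℝ) ≤ C₁ ^ (1 / 14 : ℝ) * X ^ (-0.02924 : ℝ) := by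
      calc l ^ (1 / 14 : ℝ) ≤ (C₁ * X ^ (-0.4102 : ℝ)) ^ (1 / 14 : ℝ) := by gcongr
        _ = C₁ ^ (1 / 14 : ℝ) * X ^ (-0.4102 * (1 / 14) : ℝ) := by
            rw [Real.mul_rpow (by positivity) (by positivity), ← Real.rpow_mul hX0.le]
        _ ≤ _ := by gcongr; norm_num
    have hb2 : M ^ (1 - 1 / 4 : ℝ) * l ^ (-(1 / 14) : ℝ) ≤
        C₂ ^ (-(1 / 14) : ℝ) * M * X ^ (-0.02924 : ℝ) := by
      calc M ^ (1 - 1 / 4 : ℝ) * l ^ (-(1 / 14) : ℝ)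
          ≤ M ^ (1 - 1 / 4 : ℝ) * (C₂ * X ^ (1.2261 : ℝ) * M ^ (-3.5 : ℝ)) ^ (-(1 / 14) : ℝ) := by
            gcongr ?_ * ?_
            exact Real.rpow_le_rpow_of_nonpos (by positivity) hlow (by norm_num)
        _ = C₂ ^ (-(1 / 14) : ℝ) * X ^ (1.2261 * -(1 / 14) : ℝ) *
            (M ^ (1 - 1 / 4 : ℝ) * M ^ (-3.5 * -(1 / 14) : ℝ)) := by
            rw [Real.mul_rpow (by positivity) (by positivity),
              Real.mul_rpow (by positivity) (by positivity), ← Real.rpow_mul hX0.le,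
              ← Real.rpow_mul hM0.le]
            ring
        _ = C₂ ^ (-(1 / 14) : ℝ) * M * X ^ (1.2261 * -(1 / 14) : ℝ) := by
            rw [← Real.rpow_add hM0, show (1 - 1 / 4 + -3.5 * -(1 / 14) : ℝ) = 1 by norm_num,
              Real.rpow_one]
            ring
        _ ≤ _ := by gcongr; norm_num
    calc B * (M * l ^ (1 / 14 : ℝ) + M ^ (1 - 1 / 4 : ℝ) * l ^ (-(1 / 14) : ℝ))
        ≤ B * (M * (C₁ ^ (1 / 14 : ℝ) * X ^ (-0.02924 : ℝ)) +
          C₂ ^ (-(1 / 14) : ℝ) * M * X ^ (-0.02924 : ℝ)) := by gcongr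
      _ = T := by rw [hT, hD]; ring
  have hmain := bilinear_weyl_differencing I N Q
    (fun m n => β * ((m * (⌊K⌋₊ + 1 + n) : ℕ) : ℝ) ^ c) a hT0.le ha hcorr
  have e : ∀ m : ℕ, ∑ k ∈ Finset.Ioc ⌊K⌋₊ ⌊2 * K⌋₊, eC (β * ((m * k : ℕ) : ℝ) ^ c) =
      ∑ n ∈ range N, eC (β * ((m * (⌊K⌋₊ + 1 + n) : ℕ) : ℝ) ^ c) := fun m =>
    sum_Ioc_floor_eq K fun k => eC (β * ((m * k : ℕ) : ℝ) ^ c)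
  rw [Finset.sum_congr rfl fun m _ => congrArg (a m * ·) (e m)]
  set S := ‖∑ m ∈ I, a m * ∑ n ∈ range N, eC (β * ((m * (⌊K⌋₊ + 1 + n) : ℕ) : ℝ) ^ c)‖
  have hQX : 1 ≤ Q * X ^ (-0.02924 : ℝ) := by
    calc (1 : ℝ) ≤ X ^ (0.03 + -0.02924 : ℝ) := Real.one_le_rpow hX (by norm_num)
      _ = X ^ (0.03 : ℝ) * X ^ (-0.02924 : ℝ) := Real.rpow_add hX0 _ _
      _ ≤ _ := by gcongr
  have hfin : Q * S ^ 2 ≤ Q * (2 * 4 * (2 * 2 + 2 * (2 * D)) * a₀ ^ 2 * (M * K) ^ 2 *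
      X ^ (-0.02924 : ℝ)) := by
    calc Q * S ^ 2 ≤ a₀ ^ 2 * #I * ((N + Q) * (N * #I + 2 * (Q * (N * T)))) := hmain
      _ ≤ a₀ ^ 2 * (2 * M) * ((2 * K + 2 * K) * (2 * K * (2 * M) + 2 * (Q * (2 * K * T)))) := by
          gcongr
          linarith
      _ = a₀ ^ 2 * (2 * M) * (2 * K + 2 * K) * (2 * K) * (2 * M * 1 + 2 * (Q * T)) := by ring
      _ ≤ a₀ ^ 2 * (2 * M) * (2 * K + 2 * K) * (2 * K) *
          (2 * M * (Q * X ^ (-0.02924 : ℝ)) + 2 * (Q * T)) := by gcongr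
      _ = _ := by rw [hT]; ring
  exact le_of_mul_le_mul_left hfin hQ0

theorem eventually_const_mul_rpow_le (D : ℝ) {u v : ℝ} (h : u < v) :
    ∀ᶠ X : ℝ in Filter.atTop, D * X ^ u ≤ X ^ v := by
  filter_upwards [(tendsto_rpow_atTop (sub_pos.2 h)).eventually_ge_atTop D,
    Filter.eventually_gt_atTop 0] with X h1 h2
  calc D * X ^ u ≤ X ^ (v - u) * X ^ u := by gcongr
    _ = X ^ v := by rw [← Real.rpow_add h2]; ring_nf

theorem ne_natCast_of_mem_Ioo {c : ℝ} (hc1 : 1 < c) (hc3 : c < 3) (hc2 : c ≠ 2) (j : ℕ) :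
    c ≠ j := by
  rintro rfl
  have h1 : 1 < j := by exact_mod_cast hc1
  have h3 : j < 3 := by exact_mod_cast hc3
  exact hc2 (by norm_cast; omega)

/-- A uniform power saving in the double sum for a single frequency `β`. -/
theorem norm_typeI_rpow_sum_le {c : ℝ} (hc1 : 1 < c) (hc3 : c < 3) (hc2 : c ≠ 2) {A : ℝ}
    (hA : 0 < A) :
    ∃ C > 0, ∀ᶠ X : ℝ in Filter.atTop, ∀ M K β a₀ : ℝ, 0 < M → 0 < K → 0 ≤ a₀ →
      A⁻¹ * X ≤ M * K → M * K ≤ A * X → M ≤ A * X ^ ((1371705 : ℝ) / 2666036) →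
      X ^ (0.9 : ℝ) ≤ |β| * X ^ c → |β| * X ^ c ≤ X ^ (2.0697 : ℝ) →
      ∀ a : ℕ → ℂ, (∀ m ∈ Finset.Ioc ⌊M⌋₊ ⌊2 * M⌋₊, ‖a m‖ ≤ a₀) →
        ‖∑ m ∈ Finset.Ioc ⌊M⌋₊ ⌊2 * M⌋₊, a m *
          ∑ k ∈ Finset.Ioc ⌊K⌋₊ ⌊2 * K⌋₊, eC (β * ((m * k : ℕ) : ℝ) ^ c)‖ ≤
          C * a₀ * X ^ (1 - 0.01462 : ℝ) := by
  have hc := ne_natCast_of_mem_Ioo hc1 hc3 hc2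
  obtain ⟨C₁, hC₁, h₁⟩ := differenceTest_four.dilated_rpow_sum (c := c) (σ := 0.01462)
    (κ₁ := 0.57) (κ₂ := 1.01) (φ₁ := 0.9) (φ₂ := 2.0697) (by norm_num) (by norm_num)
    (by norm_num) (by norm_num) (by linarith) (by push_cast; linarith) (fun j _ => hc j) hA
    (by norm_num) (by norm_num) (by norm_num)
  obtain ⟨C₂, hC₂, h₂⟩ := differenceTest_four.dilated_rpow_sum (c := c) (σ := 0.01462)
    (κ₁ := 0.4854) (κ₂ := 0.57) (φ₁ := 0.9) (φ₂ := 1.7) (by norm_num) (by norm_num)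
    (by norm_num) (by norm_num) (by linarith) (by push_cast; linarith) (fun j _ => hc j) hA
    (by norm_num) (by norm_num) (by norm_num)
  obtain ⟨C₃, hC₃, h₃⟩ := differenceTest_five.dilated_rpow_sum (c := c) (σ := 0.01462)
    (κ₁ := 0.502) (κ₂ := 0.57) (φ₁ := 1.7) (φ₂ := 2.0697) (by norm_num) (by norm_num)
    (by norm_num) (by norm_num) (by linarith) (by push_cast; linarith) (fun j _ => hc j) hA
    (by norm_num) (by norm_num) (by norm_num)
  obtain ⟨C₄, hC₄, h₄⟩ := differenceTest_five.dilated_rpow_sum (c := c) (σ := 0.01462)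
    (κ₁ := 0.4854) (κ₂ := 0.502) (φ₁ := 1.7) (φ₂ := 1.98) (by norm_num) (by norm_num)
    (by norm_num) (by norm_num) (by linarith) (by push_cast; linarith) (fun j _ => hc j) hA
    (by norm_num) (by norm_num) (by norm_num)
  obtain ⟨C₅, hC₅, h₅⟩ := differenceTest_six.dilated_rpow_sum (c := c) (σ := 0.01462)
    (κ₁ := 0.4966) (κ₂ := 0.502) (φ₁ := 1.98) (φ₂ := 2.0697) (by norm_num) (by norm_num)
    (by norm_num) (by norm_num) (by linarith) (by push_cast; linarith) (fun j _ => hc j) hA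
    (by norm_num) (by norm_num) (by norm_num)
  obtain ⟨C₆, hC₆, h₆⟩ := norm_bilinear_rpow_sum_le hc1 hc3 hc2 hA
  set C := 2 * A * (C₁ + C₂ + C₃ + C₄ + C₅) + √C₆ * A with hC
  have hC6 : 0 < √C₆ := Real.sqrt_pos.2 hC₆
  refine ⟨C, by positivity, ?_⟩
  filter_upwards [Filter.eventually_ge_atTop 1,
    eventually_const_mul_rpow_le (2 * A) (by norm_num : (1 : ℝ) < 1.01),
    eventually_const_mul_rpow_le (A * A) (by norm_num : (0.4854 + 1371705 / 2666036 : ℝ) < 1),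
    eventually_const_mul_rpow_le A (by norm_num : (1371705 / 2666036 : ℝ) < 0.5146),
    eventually_const_mul_rpow_le A (by norm_num : (0.5033 + 0.4966 : ℝ) < 1)]
    with X hX hX1 hX2 hX3 hX4
  intro M K β a₀ hM0 hK0 ha₀ hMK1 hMK2 hM2 hF1 hF2 a ha
  have hX0 : 0 < X := by linarith
  rw [Real.rpow_one] at hX1 hX2 hX4
  rcases lt_or_ge M (1 / 2) with hM1 | hM1
  · rw [Nat.floor_eq_zero.2 (by linarith), Nat.floor_eq_zero.2 (by linarith)]
    simp only [Finset.Ioc_self, Finset.sum_empty, norm_zero]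
    positivity
  have hK2 : K ≤ X ^ (1.01 : ℝ) := by nlinarith
  have hMK1' : X ≤ A * (M * K) := by
    rwa [inv_mul_le_iff₀ hA] at hMK1
  have hK1 : X ^ (0.4854 : ℝ) ≤ K := by
    have h1 : A * A * (X ^ (0.4854 : ℝ) * X ^ (1371705 / 2666036 : ℝ)) ≤
        A * A * (K * X ^ (1371705 / 2666036 : ℝ)) := by
      rw [← Real.rpow_add hX0]
      refine hX2.trans (hMK1'.trans ?_)
      calc A * (M * K) ≤ A * (A * X ^ (1371705 / 2666036 : ℝ) * K) := by gcongr
        _ = _ := by ring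
    exact le_of_mul_le_mul_right (le_of_mul_le_mul_left h1 (by positivity)) (by positivity)
  have hsaving : M * K * X ^ (-0.01462 : ℝ) ≤ A * X ^ (1 - 0.01462 : ℝ) := by
    calc M * K * X ^ (-0.01462 : ℝ) ≤ A * X * X ^ (-0.01462 : ℝ) := by gcongr
      _ = _ := by rw [sub_eq_add_neg, Real.rpow_add hX0, Real.rpow_one]; ring
  have hdirect : ∀ D ≥ 0, 2 * A * D ≤ C → (∀ m ∈ Finset.Ioc ⌊M⌋₊ ⌊2 * M⌋₊,
      ‖∑ k ∈ Finset.Ioc ⌊K⌋₊ ⌊2 * K⌋₊, eC (β * ((m * k : ℕ) : ℝ) ^ c)‖ ≤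
        D * K * X ^ (-0.01462 : ℝ)) →
      ‖∑ m ∈ Finset.Ioc ⌊M⌋₊ ⌊2 * M⌋₊, a m *
        ∑ k ∈ Finset.Ioc ⌊K⌋₊ ⌊2 * K⌋₊, eC (β * ((m * k : ℕ) : ℝ) ^ c)‖ ≤
        C * a₀ * X ^ (1 - 0.01462 : ℝ) := by
    intro D hD hDC hb
    have hcard : ((⌊2 * M⌋₊ - ⌊M⌋₊ : ℕ) : ℝ) ≤ 2 * M :=
      le_trans (by exact_mod_cast Nat.sub_le _ _) (Nat.floor_le (by positivity : 0 ≤ 2 * M))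
    calc _ ≤ ∑ m ∈ Finset.Ioc ⌊M⌋₊ ⌊2 * M⌋₊, a₀ * (D * K * X ^ (-0.01462 : ℝ)) :=
          norm_sum_le_of_le _ fun m hm =>
            (norm_mul_le _ _).trans (mul_le_mul (ha m hm) (hb m hm) (norm_nonneg _) ha₀)
      _ ≤ 2 * M * (a₀ * (D * K * X ^ (-0.01462 : ℝ))) := by
          rw [sum_const, Nat.card_Ioc, nsmul_eq_mul]
          gcongr
      _ = 2 * D * a₀ * (M * K * X ^ (-0.01462 : ℝ)) := by ring
      _ ≤ 2 * D * a₀ * (A * X ^ (1 - 0.01462 : ℝ)) := by gcongr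
      _ = 2 * A * D * a₀ * X ^ (1 - 0.01462 : ℝ) := by ring
      _ ≤ _ := by gcongr
  have hsq := mul_pos hC6 hA
  have hp₁ := mul_pos hA hC₁
  have hp₂ := mul_pos hA hC₂
  have hp₃ := mul_pos hA hC₃
  have hp₄ := mul_pos hA hC₄
  have hp₅ := mul_pos hA hC₅
  rcases le_or_gt (X ^ (0.57 : ℝ)) K with hKa | hKa
  · exact hdirect C₁ hC₁.le (by linarith) (h₁ X M K β hX hMK1 hMK2 hKa hK2 hF1 hF2)
  rcases le_or_gt (|β| * X ^ c) (X ^ (1.7 : ℝ)) with hFa | hFa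
  · exact hdirect C₂ hC₂.le (by linarith) (h₂ X M K β hX hMK1 hMK2 hK1 hKa.le hF1 hFa)
  rcases le_or_gt (X ^ (0.502 : ℝ)) K with hKb | hKb
  · exact hdirect C₃ hC₃.le (by linarith) (h₃ X M K β hX hMK1 hMK2 hKb hKa.le hFa.le hF2)
  rcases le_or_gt (|β| * X ^ c) (X ^ (1.98 : ℝ)) with hFb | hFb
  · exact hdirect C₄ hC₄.le (by linarith) (h₄ X M K β hX hMK1 hMK2 hK1 hKb.le hFa.le hFb)
  rcases le_or_gt (X ^ (0.4966 : ℝ)) K with hKc | hKc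
  · exact hdirect C₅ hC₅.le (by linarith) (h₅ X M K β hX hMK1 hMK2 hKc hKb.le hFb.le hF2)
  have hM3 : X ^ (0.5033 : ℝ) ≤ M := by
    have h1 : A * (X ^ (0.5033 : ℝ) * X ^ (0.4966 : ℝ)) ≤ A * (M * X ^ (0.4966 : ℝ)) := by
      rw [← Real.rpow_add hX0]
      exact hX4.trans (hMK1'.trans (by gcongr))
    exact le_of_mul_le_mul_right (le_of_mul_le_mul_left h1 hA) (by positivity)
  have hbil := h₆ X M K β a₀ hX hMK1 hMK2 ((Real.one_le_rpow hX (by norm_num)).trans hK1) hKc.le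
    hM3 (hM2.trans hX3) hFb.le hF2
    ((Real.rpow_le_rpow_of_exponent_le hX (by norm_num)).trans hK1) a ha
  have hsqrt : C₆ * a₀ ^ 2 * (M * K) ^ 2 * X ^ (-0.02924 : ℝ) =
      (√C₆ * a₀ * (M * K * X ^ (-0.01462 : ℝ))) ^ 2 := by
    rw [show (-0.02924 : ℝ) = -0.01462 + -0.01462 by norm_num, Real.rpow_add hX0]
    linear_combination (-(a₀ ^ 2 * (M * K) ^ 2 * (X ^ (-0.01462 : ℝ)) ^ 2)) * Real.sq_sqrt hC₆.le
  rw [hsqrt] at hbil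
  refine (le_of_sq_le_sq hbil (by positivity)).trans ?_
  calc √C₆ * a₀ * (M * K * X ^ (-0.01462 : ℝ))
      ≤ √C₆ * a₀ * (A * X ^ (1 - 0.01462 : ℝ)) := by gcongr
    _ = √C₆ * A * a₀ * X ^ (1 - 0.01462 : ℝ) := by ring
    _ ≤ _ := by gcongr; linarith

theorem sum_Icc_inv_one_add_abs_le (J : ℕ) :
    ∑ h ∈ Finset.Icc (-J : ℤ) J, (1 + |(h : ℝ)|)⁻¹ ≤ 2 * (1 + Real.log (J + 1)) := by
  have heven : (fun h : ℤ => (1 + |(h : ℝ)|)⁻¹).Even := fun h => by simp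
  rw [sum_Icc_of_even_eq_range heven]
  have hharm := harmonic_le_one_add_log (J + 1)
  have e : ((harmonic (J + 1) : ℚ) : ℝ) =
      ∑ m ∈ range (J + 1), (1 + |((m : ℤ) : ℝ)|)⁻¹ := by
    simp [harmonic, add_comm]
  rw [← e]
  push_cast at hharm
  simp only [nsmul_eq_mul, Nat.cast_ofNat, Int.cast_zero, abs_zero, add_zero, inv_one]
  linarith

theorem sum_Icc_floor_inv_one_add_abs_le {X H : ℝ} (hX : 1 ≤ X) (hH0 : 0 ≤ H) (hH : H ≤ X) :
    ∑ h ∈ Finset.Icc (-⌊H⌋) ⌊H⌋, (1 + |(h : ℝ)|)⁻¹ ≤ 40002 * X ^ (0.0001 : ℝ) := by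
  lift ⌊H⌋ to ℕ using Int.floor_nonneg.2 hH0 with J hJ
  have hJX : (J : ℝ) + 1 ≤ 2 * X := by
    have : ((J : ℤ) : ℝ) ≤ H := hJ ▸ Int.floor_le H
    push_cast at this
    linarith
  refine (sum_Icc_inv_one_add_abs_le J).trans ?_
  have hlog := Real.log_le_rpow_div (x := J + 1) (by positivity) (by norm_num : (0 : ℝ) < 0.0001)
  have h1 : ((J : ℝ) + 1) ^ (0.0001 : ℝ) ≤ 2 * X ^ (0.0001 : ℝ) := by
    calc ((J : ℝ) + 1) ^ (0.0001 : ℝ) ≤ (2 * X) ^ (0.0001 : ℝ) := by gcongr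
      _ = 2 ^ (0.0001 : ℝ) * X ^ (0.0001 : ℝ) := Real.mul_rpow (by norm_num) (by linarith)
      _ ≤ 2 ^ (1 : ℝ) * X ^ (0.0001 : ℝ) := by gcongr <;> norm_num
      _ = _ := by rw [Real.rpow_one]
  have h2 : 1 ≤ X ^ (0.0001 : ℝ) := Real.one_le_rpow hX (by norm_num)
  have h3 : ((J : ℝ) + 1) ^ (0.0001 : ℝ) / 0.0001 = 10000 * ((J : ℝ) + 1) ^ (0.0001 : ℝ) := by
    norm_num
    ring
  linarith

/-- The distance of `h + α` from zero, for integers `h`, when `α` lies in `(τ, 1 - τ)`. -/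
theorem le_abs_intCast_add {τ α : ℝ} (h1 : τ ≤ α) (h2 : α ≤ 1 - τ) (h : ℤ) :
    τ ≤ |(h : ℝ) + α| := by
  rcases le_or_gt 0 h with h0 | h0
  · have : (0 : ℝ) ≤ h := by exact_mod_cast h0
    exact le_abs.2 (Or.inl (by linarith))
  · have : (h : ℝ) ≤ -1 := by exact_mod_cast Int.le_sub_one_of_lt h0
    exact le_abs.2 (Or.inr (by linarith))

theorem stmt_10 (c : ℝ) (hc1 : 1 < c) (hc2 : c < 4109054 / 1999527) (hc3 : c ≠ 2) :
    ∃ ε₀ > 0, ∀ ε : ℝ, 0 < ε → ε ≤ ε₀ → ∀ A : ℝ, 0 < A →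
      ∃ C > 0, ∃ P₀ : ℝ, ∀ P : ℝ, P₀ ≤ P →
        ∀ X M K : ℝ, 0 < M → 0 < K →
          A⁻¹ * P ^ ((9449 : ℝ) / 10000) ≤ X → X ≤ A * P →
          A⁻¹ * X ≤ M * K → M * K ≤ A * X →
          M ≤ A * X ^ ((1371705 : ℝ) / 2666036) →
          ∀ ch : ℤ → ℂ, (∀ h : ℤ, ‖ch h‖ ≤ A / (1 + |(h : ℝ)|)) →
          ∀ a : ℕ → ℂ, (∀ m : ℕ, ‖a m‖ ≤ A * (m : ℝ) ^ ε) →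
          ∀ α : ℝ, P ^ (1 - c - ε) < α → α < 1 - P ^ (1 - c - ε) →
            ‖∑ h ∈ Finset.Icc (-⌊X ^ ((38687 : ℝ) / 2666036)⌋) ⌊X ^ ((38687 : ℝ) / 2666036)⌋,
                ch h * ∑ m ∈ Finset.Ioc ⌊M⌋₊ ⌊2 * M⌋₊, a m *
                  ∑ k ∈ Finset.Ioc ⌊K⌋₊ ⌊2 * K⌋₊,
                    eC (((h : ℝ) + α) * ((m * k : ℕ) : ℝ) ^ c)‖
              ≤ C * X ^ ((2627349 : ℝ) / 2666036 + ε) := by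
  refine ⟨0.001, by norm_num, fun ε hε hε₀ A hA => ?_⟩
  norm_num at hε₀
  obtain ⟨C, hC, hev⟩ := norm_typeI_rpow_sum_le hc1 (by linarith) hc3 hA
  obtain ⟨X₀, hX₀⟩ := Filter.eventually_atTop.1 <| hev.and <|
    (Filter.eventually_ge_atTop 1).and <|
    (eventually_const_mul_rpow_le A (by norm_num : (1 : ℝ) < 1.001)).and <|
    (eventually_const_mul_rpow_le 2 (by norm_num : (2.0696 : ℝ) < 2.0697)).and <|
    eventually_const_mul_rpow_le (2 * A) (by norm_num : (1371705 / 2666036 : ℝ) < 1)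
  obtain ⟨P₀, hP₀⟩ := Filter.eventually_atTop.1 <| (Filter.eventually_ge_atTop 1).and <|
    (tendsto_rpow_atTop (by norm_num : (0 : ℝ) < 9449 / 10000)).eventually_ge_atTop (A * X₀)
  refine ⟨A * A * C * 40002, by positivity, P₀, ?_⟩
  intro P hP X M K hM0 hK0 hPX hXP hMK1 hMK2 hM ch hch a ha α hα1 hα2
  obtain ⟨hP1, hPX₀⟩ := hP₀ P hP
  have hP0 : 0 < P := by linarith
  rw [inv_mul_le_iff₀ hA] at hPX
  obtain ⟨hbound, hX1, hX2, hX3, hX4⟩ :=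
    hX₀ X (le_of_mul_le_mul_left (hPX₀.trans hPX) hA)
  have hX0 : 0 < X := by linarith
  rw [Real.rpow_one] at hX2 hX4
  set H := X ^ ((38687 : ℝ) / 2666036) with hH
  have hH1 : 1 ≤ H := Real.one_le_rpow hX1 (by norm_num)
  have hHX : H ≤ X := Real.rpow_le_self_of_one_le hX1 (by norm_num)
  have hτ : X ^ (0.9 - c) ≤ P ^ (1 - c - ε) := by
    have hPX' : P ≤ X ^ (1.06 : ℝ) := by
      calc P = (P ^ (9449 / 10000 : ℝ)) ^ (10000 / 9449 : ℝ) := by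
            rw [← Real.rpow_mul hP0.le]; norm_num
        _ ≤ (X ^ (1.001 : ℝ)) ^ (10000 / 9449 : ℝ) := by
            gcongr
            exact hPX.trans hX2
        _ ≤ X ^ (1.06 : ℝ) := by
            rw [← Real.rpow_mul hX0.le]
            exact Real.rpow_le_rpow_of_exponent_le hX1 (by norm_num)
    calc X ^ (0.9 - c) ≤ X ^ (1.06 * (1 - c - ε)) :=
          Real.rpow_le_rpow_of_exponent_le hX1 (by linarith)
      _ = (X ^ (1.06 : ℝ)) ^ (1 - c - ε) := Real.rpow_mul hX0.le _ _
      _ ≤ _ := Real.rpow_le_rpow_of_nonpos hP0 hPX' (by linarith)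
  have hτ0 : 0 < P ^ (1 - c - ε) := by positivity
  have hfreq : ∀ h ∈ Finset.Icc (-⌊H⌋) ⌊H⌋, X ^ (0.9 : ℝ) ≤ |(h : ℝ) + α| * X ^ c ∧
      |(h : ℝ) + α| * X ^ c ≤ X ^ (2.0697 : ℝ) := by
    intro h hh
    rw [Finset.mem_Icc] at hh
    have hh1 : (h : ℝ) ≤ H := le_trans (by exact_mod_cast hh.2) (Int.floor_le H)
    have hh2 : -H ≤ h := by
      have : ((-⌊H⌋ : ℤ) : ℝ) ≤ h := by exact_mod_cast hh.1
      push_cast at this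
      linarith [Int.floor_le H]
    constructor
    · calc X ^ (0.9 : ℝ) = X ^ (0.9 - c) * X ^ c := by rw [← Real.rpow_add hX0]; ring_nf
        _ ≤ _ := by
          gcongr
          exact hτ.trans (le_abs_intCast_add hα1.le hα2.le h)
    · have habs : |(h : ℝ) + α| ≤ 2 * H := abs_le.2 ⟨by linarith, by linarith⟩
      calc |(h : ℝ) + α| * X ^ c ≤ 2 * H * X ^ c := by gcongr
        _ = 2 * X ^ (38687 / 2666036 + c) := by rw [hH, Real.rpow_add hX0]; ring
        _ ≤ 2 * X ^ (2.0696 : ℝ) := by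
          gcongr
          linarith
        _ ≤ _ := hX3
  have ha₀ : ∀ m ∈ Finset.Ioc ⌊M⌋₊ ⌊2 * M⌋₊, ‖a m‖ ≤ A * X ^ ε := by
    intro m hm
    have hm2 : (m : ℝ) ≤ 2 * M := (Nat.le_floor_iff (by positivity)).1 (Finset.mem_Ioc.1 hm).2
    refine (ha m).trans ?_
    gcongr
    linarith
  have hinner := fun (h : ℤ) hh => hbound M K ((h : ℝ) + α) (A * X ^ ε) hM0 hK0 (by positivity) hMK1
    hMK2 hM (hfreq h hh).1 (hfreq h hh).2 a ha₀
  set S := C * (A * X ^ ε) * X ^ (1 - 0.01462 : ℝ) with hS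
  have hS0 : 0 < S := by positivity
  calc _ ≤ ∑ h ∈ Finset.Icc (-⌊H⌋) ⌊H⌋, A * S * (1 + |(h : ℝ)|)⁻¹ := by
        refine norm_sum_le_of_le _ fun h hh => (norm_mul_le _ _).trans ?_
        refine (mul_le_mul (hch h) (hinner h hh) (norm_nonneg _) (by positivity)).trans_eq ?_
        ring
    _ ≤ A * S * (40002 * X ^ (0.0001 : ℝ)) := by
        rw [← Finset.mul_sum]
        gcongr
        exact sum_Icc_floor_inv_one_add_abs_le hX1 (by linarith) hHX
    _ = A * A * C * 40002 * X ^ ((1 - 0.01462 + 0.0001 : ℝ) + ε) := by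
        rw [hS, Real.rpow_add hX0, Real.rpow_add hX0]
        ring
    _ ≤ _ := by
        gcongr
        norm_num
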